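/- Symplectic non-squeezing in dimension 4: for r, R > 0, there exists a symplectic embedding of the open ball B⁴_r = {x ∈ ℝ⁴ : |x| < r} into the open cylinder Z_R = {(x₁, y₁, x₂, y₂) ∈ ℝ⁴ : x₁² + y₁² < R²} — that is, a smooth injective map φ : B⁴_r → ℝ⁴ with φ(B⁴_r) ⊆ Z_R whose derivative preserves ω_st, i.e. ω_st(Dφ_x(u), Dφ_x(v)) = ω_st(u, v) for all x ∈ B⁴_r and u, v ∈ ℝ⁴ — if and only if r ≤ R. -/

import Mathlib

noncomputable section

open scoped ContDiff
open Real

/-- ℝ⁴ with the Euclidean inner product. -/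
abbrev R4 : Type := EuclideanSpace ℝ (Fin 4)

/-- The standard symplectic form ω_st = dx₁∧dy₁ + dx₂∧dy₂ on ℝ⁴. -/
def omegaSt (u v : R4) : ℝ := u 0 * v 1 - u 1 * v 0 + u 2 * v 3 - u 3 * v 2

section Brouwer

open MeasureTheory Module

variable {E : Type*} [NormedAddCommGroup E] [InnerProductSpace ℝ E] [FiniteDimensional ℝ E]

/-- The determinant of `1 + A` is recovered by interpolation from those of `1 + t • A`. -/
lemma det_one_add_eq_sum_basis (A : E →L[ℝ] E) (s : Finset ℝ) (hs : finrank ℝ E < s.card) :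
    (1 + A).det = ∑ t ∈ s, (Lagrange.basis s id t).eval 1 * (1 + t • A).det := by
  classical
  let b := finBasis ℝ E
  let M := LinearMap.toMatrix b b (A : E →ₗ[ℝ] E)
  let p : Polynomial ℝ := (((Polynomial.X : Polynomial ℝ) • M.map Polynomial.C
    + (1 : Matrix _ _ ℝ).map Polynomial.C).det)
  have hp : ∀ t : ℝ, p.eval t = (1 + t • A).det := by
    intro t
    simp only [p, ContinuousLinearMap.det]
    rw [← LinearMap.det_toMatrix b, ← Polynomial.coe_evalRingHom, RingHom.map_det]
    congr 1
    ext i j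
    have h1 : Polynomial.eval t (if i = j then 1 else 0) = if i = j then (1 : ℝ) else 0 := by
      split_ifs <;> simp
    simp [M, LinearMap.toMatrix_apply, Matrix.one_apply, Finsupp.single_apply, eq_comm, h1]
    ring
  have hdeg : p.degree < s.card := by
    refine lt_of_le_of_lt Polynomial.degree_le_natDegree ?_
    have := Polynomial.natDegree_det_X_add_C_le M 1
    rw [Fintype.card_fin] at this
    exact_mod_cast lt_of_le_of_lt this hs
  have h := Lagrange.eq_interpolate (s := s) (v := id) (f := p) Function.injective_id.injOn hdeg
  have h1 := congrArg (Polynomial.eval 1) h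
  rw [hp, one_smul, Lagrange.interpolate_apply, Polynomial.eval_finsetSum] at h1
  rw [h1]
  refine Finset.sum_congr rfl fun t _ => ?_
  rw [Polynomial.eval_mul, Polynomial.eval_C, id, hp, mul_comm]

lemma sum_eval_basis_one (s : Finset ℝ) (hs : s.Nonempty) :
    ∑ t ∈ s, (Lagrange.basis s id t).eval 1 = (1 : ℝ) := by
  rw [← Polynomial.eval_finsetSum, Lagrange.sum_basis Function.injective_id.injOn hs,
    Polynomial.eval_one]

lemma det_one_add_pos (A : E →L[ℝ] E) (hA : ‖A‖ < 1) : 0 < (1 + A).det := by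
  have hne : ∀ s ∈ Set.Icc (0 : ℝ) 1, (1 + s • A).det ≠ 0 := by
    intro s hs
    have hn : ‖-(s • A)‖ < 1 := by
      rw [norm_neg, norm_smul, Real.norm_eq_abs, abs_of_nonneg hs.1]
      exact lt_of_le_of_lt (mul_le_of_le_one_left (norm_nonneg _) hs.2) hA
    have hu : IsUnit (1 + s • A) := by
      have := (Units.oneSub _ hn).isUnit
      simpa using this
    obtain ⟨u, hu⟩ := hu
    have h1 : (1 + s • A).det * ((u⁻¹ : (E →L[ℝ] E)ˣ) : E →L[ℝ] E).det = 1 := by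
      rw [← hu]
      simp only [ContinuousLinearMap.det]
      rw [← LinearMap.det_comp]
      have : (((u : E →L[ℝ] E) : E →ₗ[ℝ] E) ∘ₗ ((u⁻¹ : (E →L[ℝ] E)ˣ) : E →L[ℝ] E))
          = LinearMap.id := by
        ext x
        exact congrArg (fun B : E →L[ℝ] E => B x) u.mul_inv
      rw [this, LinearMap.det_id]
    intro h0
    rw [h0, zero_mul] at h1
    exact zero_ne_one h1
  by_contra! hle
  have hc : ContinuousOn (fun s : ℝ => (1 + s • A).det) (Set.Icc 0 1) := by
    have : Continuous (fun s : ℝ => (1 + s • A).det) :=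
      ContinuousLinearMap.continuous_det.comp (by fun_prop)
    exact this.continuousOn
  have h0 : (1 + (0 : ℝ) • A).det = 1 := by simp [ContinuousLinearMap.det]
  have h1 : (1 + (1 : ℝ) • A).det ≤ 0 := by simpa using hle
  have := intermediate_value_Icc' zero_le_one hc (show (0 : ℝ) ∈ Set.Icc _ _ from ⟨h1, by
    simp only [h0]; exact zero_le_one⟩)
  obtain ⟨s, hs, hs0⟩ := this
  exact hne s hs hs0

omit [FiniteDimensional ℝ E] in
lemma lipschitzWith_of_lipschitzOnWith_closedBall {F : Type*} [NormedAddCommGroup F] {R : ℝ} {K : NNReal} {g : E → F}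
    (hg : LipschitzOnWith K g (Metric.closedBall 0 R))
    (h0 : ∀ x, R ≤ ‖x‖ → g x = 0) : LipschitzWith K g := by
  have key : ∀ x y, ‖x‖ ≤ R → R ≤ ‖y‖ → ‖g x - g y‖ ≤ K * ‖x - y‖ := by
    intro x y hx hy
    have hc : ContinuousOn (fun t : ℝ => ‖AffineMap.lineMap x y t‖) (Set.Icc 0 1) :=
      (continuous_norm.comp AffineMap.lineMap_continuous).continuousOn
    obtain ⟨t, ht, htR⟩ := intermediate_value_Icc zero_le_one hc
      (show R ∈ Set.Icc _ _ by simpa using ⟨hx, hy⟩)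
    set z : E := AffineMap.lineMap x y t with hz
    have hzR : ‖z‖ = R := htR
    rw [h0 y hy, ← h0 z hzR.ge]
    refine (hg.norm_sub_le (by simpa using hx) (by simpa using hzR.le)).trans ?_
    gcongr
    have : x - z = t • (x - y) := by
      rw [hz, AffineMap.lineMap_apply_module']; module
    rw [this, norm_smul, Real.norm_eq_abs, abs_of_nonneg ht.1]
    exact mul_le_of_le_one_left (norm_nonneg _) ht.2
  refine LipschitzWith.of_dist_le_mul fun x y => ?_
  rw [dist_eq_norm, dist_eq_norm]
  rcases le_total ‖x‖ R with hx | hx <;> rcases le_total ‖y‖ R with hy | hy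
  · exact hg.norm_sub_le (by simpa using hx) (by simpa using hy)
  · exact key x y hx hy
  · rw [norm_sub_rev, norm_sub_rev x]; exact key y x hy hx
  · rw [h0 x hx, h0 y hy]; simp; positivity

lemma bijective_add_smul_of_lipschitz {K : NNReal} {g : E → E} (hg : LipschitzWith K g) {t : ℝ}
    (ht : |t| * K < 1) : Function.Bijective (fun x => x + t • g x) := by
  rcases subsingleton_or_nontrivial E with hE | hE
  · exact ⟨Function.injective_of_subsingleton _, fun y => ⟨y, Subsingleton.elim _ _⟩⟩
  have hA : ApproximatesLinearOn (fun x => x + t • g x)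
      ((ContinuousLinearEquiv.refl ℝ E : E ≃L[ℝ] E) : E →L[ℝ] E) Set.univ (‖t‖₊ * K) := by
    intro x _ y _
    have : x + t • g x - (y + t • g y)
        - ((ContinuousLinearEquiv.refl ℝ E : E ≃L[ℝ] E) : E →L[ℝ] E) (x - y) = t • (g x - g y) := by
      simp; module
    rw [this, norm_smul]
    push_cast
    rw [mul_assoc]
    gcongr
    exact hg.norm_sub_le x y
  have hc : ‖t‖₊ * K < ‖(((ContinuousLinearEquiv.refl ℝ E).symm : E ≃L[ℝ] E) : E →L[ℝ] E)‖₊⁻¹ := by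
    have : ‖(((ContinuousLinearEquiv.refl ℝ E).symm : E ≃L[ℝ] E) : E →L[ℝ] E)‖₊ = 1 := by
      rw [← NNReal.coe_inj]
      exact ContinuousLinearMap.norm_id
    rw [this, inv_one, ← NNReal.coe_lt_coe]
    simpa using ht
  exact ⟨Set.injOn_univ.1 (hA.injOn (Or.inr hc)), hA.surjective (Or.inr hc)⟩

variable [MeasurableSpace E] [BorelSpace E]

/-- There is no `C¹` retraction of a ball onto its boundary sphere. -/
theorem no_contDiff_retraction {R : ℝ} (hR : 0 < R) {f : E → E} (hf : ContDiff ℝ 1 f)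
    (hnorm : ∀ x, ‖f x‖ = R) (hid : ∀ x, ‖x‖ = R → f x = x) : False := by
  classical
  set B := Metric.ball (0 : E) R with hB
  let g : E → E := fun x => if ‖x‖ ≤ R then f x - x else 0
  have hgout : ∀ x, R ≤ ‖x‖ → g x = 0 := by
    intro x hx
    simp only [g]
    split_ifs with h
    · rw [hid x (le_antisymm h hx), sub_self]
    · rfl
  obtain ⟨K, hK⟩ : ∃ K, LipschitzOnWith K (fun x => f x - x) (Metric.closedBall 0 R) :=
    (hf.sub contDiff_id).contDiffOn.exists_lipschitzOnWith one_ne_zero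
      (convex_closedBall _ _) (isCompact_closedBall _ _)
  have hgL : LipschitzWith K g := by
    refine lipschitzWith_of_lipschitzOnWith_closedBall (R := R) ?_ hgout
    intro x hx y hy
    simp only [mem_closedBall_zero_iff] at hx hy
    simp only [g, hx, hy, if_true]
    exact hK (by simpa using hx) (by simpa using hy)
  let A : E → E →L[ℝ] E := fun x => fderiv ℝ f x - 1
  have hgd : ∀ x ∈ B, HasFDerivAt g (A x) x := by
    intro x hx
    have h1 : HasFDerivAt (fun x => f x - x) (A x) x :=
      ((hf.differentiable one_ne_zero) x).hasFDerivAt.sub (hasFDerivAt_id x)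
    refine h1.congr_of_eventuallyEq ?_
    filter_upwards [Metric.isOpen_ball.mem_nhds hx] with y hy
    simp only [g, (mem_ball_zero_iff.1 hy).le, if_true]
  have hAK : ∀ x ∈ B, ‖A x‖ ≤ K := fun x hx => (hgd x hx).le_of_lipschitz hgL
  have hAc : Continuous A := (hf.continuous_fderiv one_ne_zero).sub continuous_const
  have hdetc : ∀ t : ℝ, Continuous fun x => (1 + t • A x).det := fun t =>
    ContinuousLinearMap.continuous_det.comp (by fun_prop)
  have hvol : ∀ t : ℝ, 0 < t → t * K < 1 →
      ∫ x in B, (1 + t • A x).det = (volume B).toReal := by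
    intro t ht0 ht
    have hbij := bijective_add_smul_of_lipschitz hgL (t := t) (by rwa [abs_of_pos ht0])
    have himg : (fun x => x + t • g x) '' B = B := by
      have hc : (fun x => x + t • g x) '' Bᶜ = Bᶜ := by
        have : ∀ x ∈ Bᶜ, x + t • g x = x := by
          intro x hx
          rw [hgout x (by simpa [hB] using hx), smul_zero, add_zero]
        ext y
        constructor
        · rintro ⟨x, hx, rfl⟩
          simpa only [this x hx] using hx
        · intro hy
          exact ⟨y, hy, this y hy⟩
      rw [Set.image_compl_eq hbij] at hc
      exact compl_injective hc
    have hcv := integral_image_eq_integral_abs_det_fderiv_smul volume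
      (Metric.isOpen_ball (x := (0 : E)) (ε := R)).measurableSet
      (f := fun x => x + t • g x) (f' := fun x => 1 + t • A x)
      (fun x hx => ((hasFDerivAt_id x).add ((hgd x hx).const_smul t)).hasFDerivWithinAt)
      hbij.1.injOn (fun _ => (1 : ℝ))
    rw [himg] at hcv
    rw [integral_const] at hcv
    simp only [smul_eq_mul, mul_one] at hcv
    rw [show (volume B).toReal = (volume.restrict B).real Set.univ by simp [Measure.real], hcv]
    refine setIntegral_congr_fun Metric.isOpen_ball.measurableSet fun x hx => ?_
    rw [abs_of_pos]
    apply det_one_add_pos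
    rw [norm_smul, Real.norm_eq_abs, abs_of_pos ht0]
    exact lt_of_le_of_lt (by gcongr; exact hAK x hx) ht
  obtain ⟨s, hsub, hcard⟩ : ∃ s : Finset ℝ, (s : Set ℝ) ⊆ Set.Ioo 0 (1 / (K + 1)) ∧
      s.card = finrank ℝ E + 1 :=
    (Set.Ioo_infinite (by positivity)).exists_subset_card_eq _
  have hint : ∀ t : ℝ, IntegrableOn (fun x => (1 + t • A x).det) B volume := fun t =>
    ((hdetc t).continuousOn.integrableOn_compact (isCompact_closedBall (0 : E) R)).mono_set
      Metric.ball_subset_closedBall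
  have h1 : ∫ x in B, (1 + A x).det = (volume B).toReal := by
    calc ∫ x in B, (1 + A x).det
        = ∫ x in B, ∑ t ∈ s, (Lagrange.basis s id t).eval 1 * (1 + t • A x).det := by
          refine integral_congr_ae (Filter.Eventually.of_forall fun x => ?_)
          exact det_one_add_eq_sum_basis (A x) s (by omega)
      _ = ∑ t ∈ s, (Lagrange.basis s id t).eval 1 * ∫ x in B, (1 + t • A x).det := by
          rw [integral_finsetSum _ fun t _ => (hint t).const_mul _]
          simp_rw [integral_const_mul]
      _ = ∑ t ∈ s, (Lagrange.basis s id t).eval 1 * (volume B).toReal := by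
          refine Finset.sum_congr rfl fun t ht => ?_
          have := hsub ht
          rw [hvol t this.1]
          have h2 := this.2
          rw [lt_div_iff₀ (by positivity)] at h2
          nlinarith [this.1]
      _ = (volume B).toReal := by
          rw [← Finset.sum_mul, sum_eval_basis_one s (Finset.card_pos.1 (by omega)), one_mul]
  have h0 : ∫ x in B, (1 + A x).det = 0 := by
    refine integral_eq_zero_of_ae (Filter.Eventually.of_forall fun x => ?_)
    simp only [A, add_sub_cancel, Pi.zero_apply]
    by_contra hne
    have hd := ((hf.differentiable one_ne_zero) x).hasFDerivAt
    have hperp : ∀ v, inner ℝ (f x) (fderiv ℝ f x v) = 0 := by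
      intro v
      have h2 := (hd.inner ℝ hd)
      have h3 : (fun t => inner ℝ (f t) (f t)) = fun _ => R ^ 2 := by
        funext t; rw [real_inner_self_eq_norm_sq, hnorm]
      rw [h3] at h2
      have h4 := congrArg (fun L : E →L[ℝ] ℝ => L v) (h2.unique (hasFDerivAt_const _ _))
      simp [real_inner_comm] at h4
      linarith
    have hunit : IsUnit (LinearMap.det (fderiv ℝ f x : E →ₗ[ℝ] E)) := isUnit_iff_ne_zero.2 hne
    obtain ⟨v, hv⟩ := ((LinearEquiv.ofIsUnitDet (f := (fderiv ℝ f x : E →ₗ[ℝ] E))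
      (v := finBasis ℝ E) (v' := finBasis ℝ E)
      (by rwa [LinearMap.det_toMatrix])).surjective) (f x)
    have hv' : fderiv ℝ f x v = f x := hv
    have := hperp v
    rw [hv', real_inner_self_eq_norm_sq, hnorm] at this
    have : (0 : ℝ) < R ^ 2 := by positivity
    linarith
  rw [h0] at h1
  have hpos : 0 < (volume B).toReal :=
    ENNReal.toReal_pos (Metric.measure_ball_pos volume 0 hR).ne' measure_ball_lt_top.ne
  linarith

omit [MeasurableSpace E] [BorelSpace E] in
lemma surjective_of_eq_id_outside_ball {F : E → E} (hF : Continuous F) {R : ℝ}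
    (hid : ∀ x, R ≤ ‖x‖ → F x = x) : Function.Surjective F := by
  by_contra hsurj
  obtain ⟨y, hy⟩ : ∃ y, ∀ x, F x ≠ y := by
    simpa [Function.Surjective] using hsurj
  have hyR : ‖y‖ < R := by
    by_contra! h
    exact hy y (hid y h)
  obtain ⟨ε, hε, hεy⟩ : ∃ ε > 0, ∀ x, ε ≤ ‖F x - y‖ := by
    obtain ⟨x₀, -, hmin⟩ := (isCompact_closedBall (0 : E) R).exists_isMinOn
      ⟨y, by simpa using hyR.le⟩ (f := fun x => ‖F x - y‖) (by fun_prop)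
    refine ⟨min ‖F x₀ - y‖ (R - ‖y‖), lt_min (norm_pos_iff.2 (sub_ne_zero.2 (hy x₀)))
      (by linarith), fun x => ?_⟩
    rcases le_total ‖x‖ R with h | h
    · exact (min_le_left _ _).trans (hmin (by simpa using h))
    · rw [hid x h]
      refine (min_le_right _ _).trans ?_
      linarith [norm_sub_norm_le x y]
  obtain ⟨G, hG, hGd, hGid⟩ : ∃ G : E → E, ContDiff ℝ 1 G ∧ (∀ x, dist (G x) (F x) < ε) ∧
      Set.EqOn G F {x | R + 1 ≤ ‖x‖} := by
    obtain ⟨G, h1, h2, h3, -⟩ := hF.exists_contDiff_approx_and_eqOn 1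
      (ε := fun _ => ε) continuous_const (fun _ => hε)
      (S := {x | R + 1 ≤ ‖x‖}) (U := {x | R < ‖x‖}) (isClosed_le continuous_const continuous_norm)
      ((isOpen_lt continuous_const continuous_norm).mem_nhdsSet.2 fun x hx =>
        lt_of_lt_of_le (lt_add_one R) hx)
      (contDiffOn_id.congr fun x hx => hid x (le_of_lt hx))
    exact ⟨G, h1, h2, h3⟩
  have hGy : ∀ x, G (x + y) - y ≠ 0 := by
    intro x hx
    have h2 := hGd (x + y)
    rw [sub_eq_zero.1 hx, dist_comm, dist_eq_norm] at h2
    linarith [hεy (x + y)]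
  set ρ := R + 1 + ‖y‖ with hρ
  have hρ0 : 0 < ρ := by linarith [norm_nonneg y]
  borelize E
  refine no_contDiff_retraction hρ0 (f := fun x => (ρ * ‖G (x + y) - y‖⁻¹) • (G (x + y) - y))
    ?_ ?_ ?_
  · have h1 : ContDiff ℝ 1 fun x => G (x + y) - y := by fun_prop
    exact (contDiff_const.mul ((h1.norm ℝ hGy).inv fun x => norm_ne_zero_iff.2 (hGy x))).smul h1
  · intro x
    rw [norm_smul, norm_mul, norm_inv, norm_norm, Real.norm_eq_abs, abs_of_pos hρ0, mul_assoc,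
      inv_mul_cancel₀ (norm_ne_zero_iff.2 (hGy x)), mul_one]
  · intro x hx
    have h1 : R + 1 ≤ ‖x + y‖ := by
      have := norm_sub_norm_le x (-y)
      rw [norm_neg, sub_neg_eq_add] at this
      linarith
    have h2 : G (x + y) - y = x := by
      rw [hGid h1, hid _ (by linarith), add_sub_cancel_right]
    simp only [h2]
    rw [hx, mul_inv_cancel₀ hρ0.ne', one_smul]

/-- A continuous self-map of a finite-dimensional space which is the identity outside a bounded
set is surjective. -/
theorem surjective_of_eq_id_outside_bounded {W : Type*} [NormedAddCommGroup W] [NormedSpace ℝ W]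
    [FiniteDimensional ℝ W] {F : W → W} (hF : Continuous F) {R : ℝ}
    (hid : ∀ x, R ≤ ‖x‖ → F x = x) : Function.Surjective F := by
  let e := toEuclidean (E := W)
  obtain ⟨M, hM, hMe⟩ := (e.toContinuousLinearMap).bound
  have hsurj : Function.Surjective (e ∘ F ∘ e.symm) := by
    refine surjective_of_eq_id_outside_ball (R := M * R)
      (e.continuous.comp (hF.comp e.symm.continuous)) fun x hx => ?_
    have h1 : ‖e (e.symm x)‖ ≤ M * ‖e.symm x‖ := hMe _
    rw [e.apply_symm_apply] at h1
    have h : R ≤ ‖e.symm x‖ := le_of_mul_le_mul_left (hx.trans h1) hM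
    simp [hid _ h]
  intro y
  obtain ⟨x, hx⟩ := hsurj (e y)
  exact ⟨e.symm x, e.injective hx⟩

end Brouwer

section FourierModes

/-- The Fourier character `t ↦ exp (2πikt)`. -/
def fourierMode (k : ℤ) (t : ℝ) : ℂ := Complex.exp (2 * π * Complex.I * k * t)

@[fun_prop]
lemma continuous_fourierMode (k : ℤ) : Continuous (fourierMode k) := by
  unfold fourierMode; fun_prop

lemma fourierMode_zero (t : ℝ) : fourierMode 0 t = 1 := by simp [fourierMode]

lemma fourierMode_add (j k : ℤ) (t : ℝ) :
    fourierMode (j + k) t = fourierMode j t * fourierMode k t := by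
  rw [fourierMode, fourierMode, fourierMode, ← Complex.exp_add]
  push_cast; ring_nf

lemma conj_fourierMode (k : ℤ) (t : ℝ) :
    (starRingEnd ℂ) (fourierMode k t) = fourierMode (-k) t := by
  rw [fourierMode, fourierMode, ← Complex.exp_conj]
  simp [Complex.conj_ofNat]

lemma fourierMode_add_one (k : ℤ) (t : ℝ) : fourierMode k (t + 1) = fourierMode k t := by
  rw [fourierMode, fourierMode, Complex.exp_eq_exp_iff_exists_int]
  exact ⟨k, by push_cast; ring⟩

lemma hasDerivAt_fourierMode (k : ℤ) (t : ℝ) :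
    HasDerivAt (fourierMode k) (2 * π * k * Complex.I * fourierMode k t) t := by
  have h1 : HasDerivAt (fun t : ℝ => 2 * π * Complex.I * k * (t : ℂ))
      (2 * π * Complex.I * k) t := by
    simpa using (Complex.ofRealCLM.hasDerivAt (x := t)).const_mul (2 * π * Complex.I * k)
  refine h1.cexp.congr_deriv ?_
  rw [fourierMode]; ring

lemma integral_fourierMode (k : ℤ) :
    ∫ t in (0 : ℝ)..1, fourierMode k t = if k = 0 then 1 else 0 := by
  split_ifs with h
  · simp [h, fourierMode_zero]
  · have hc : (2 * π * k * Complex.I : ℂ) ≠ 0 := by simp [h, Real.pi_ne_zero]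
    have hd : ∀ t ∈ Set.uIcc (0 : ℝ) 1, HasDerivAt
        (fun t => (2 * π * k * Complex.I)⁻¹ * fourierMode k t) (fourierMode k t) t := fun t _ => by
      refine ((hasDerivAt_fourierMode k t).const_mul _).congr_deriv ?_
      rw [← mul_assoc, inv_mul_cancel₀ hc, one_mul]
    rw [intervalIntegral.integral_eq_sub_of_hasDerivAt hd
      ((continuous_fourierMode k).intervalIntegrable _ _)]
    have := fourierMode_add_one k 0
    rw [zero_add] at this
    rw [this, sub_self]

variable {E : Type*} [NormedAddCommGroup E] [InnerProductSpace ℂ E]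

/-- The real part of the inner product of a complex inner product space. -/
def rinner (x y : E) : ℝ := (inner ℂ x y).re

lemma rinner_add_left (x y z : E) : rinner (x + y) z = rinner x z + rinner y z := by
  simp [rinner]

lemma rinner_add_right (x y z : E) : rinner x (y + z) = rinner x y + rinner x z := by
  simp [rinner]

lemma rinner_sub_left (x y z : E) : rinner (x - y) z = rinner x z - rinner y z := by
  simp [rinner]

lemma rinner_smul_left (c : ℝ) (x y : E) : rinner ((c : ℂ) • x) y = c * rinner x y := by
  simp [rinner]

lemma rinner_smul_right (c : ℝ) (x y : E) : rinner x ((c : ℂ) • y) = c * rinner x y := by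
  simp [rinner]

lemma rinner_comm (x y : E) : rinner x y = rinner y x := by
  rw [rinner, ← inner_conj_symm, Complex.conj_re, rinner]

lemma rinner_self (x : E) : rinner x x = ‖x‖ ^ 2 := by
  rw [rinner, inner_self_eq_norm_sq_to_K]
  norm_cast

lemma rinner_I_smul_self (x : E) : rinner x (Complex.I • x) = 0 := by
  rw [rinner, inner_smul_right, inner_self_eq_norm_sq_to_K]
  simp [← Complex.ofReal_pow]

lemma abs_rinner_le (x y : E) : |rinner x y| ≤ ‖x‖ * ‖y‖ :=
  (Complex.abs_re_le_norm _).trans (norm_inner_le_norm x y)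

@[fun_prop]
lemma Continuous.rinner {X : Type*} [TopologicalSpace X] {f g : X → E} (hf : Continuous f)
    (hg : Continuous g) : Continuous fun t => rinner (f t) (g t) :=
  Complex.continuous_re.comp (Continuous.inner hf hg)

lemma norm_add_sq_rinner (x y : E) : ‖x + y‖ ^ 2 = ‖x‖ ^ 2 + 2 * rinner x y + ‖y‖ ^ 2 := by
  rw [← rinner_self, rinner_add_left, rinner_add_right, rinner_add_right, rinner_self, rinner_self,
    rinner_comm y x]
  ring

/-- The trigonometric polynomial with the coefficients `a k` for `-N ≤ k ≤ N`. -/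
def trigPoly (N : ℤ) (a : ℤ → E) (t : ℝ) : E := ∑ k ∈ Finset.Icc (-N) N, fourierMode k t • a k

@[fun_prop]
lemma continuous_trigPoly (N : ℤ) (a : ℤ → E) : Continuous (trigPoly N a) := by
  unfold trigPoly; fun_prop

lemma trigPoly_add (N : ℤ) (a b : ℤ → E) (t : ℝ) :
    trigPoly N (a + b) t = trigPoly N a t + trigPoly N b t := by
  simp [trigPoly, Finset.sum_add_distrib]

lemma trigPoly_add_one (N : ℤ) (a : ℤ → E) (t : ℝ) :
    trigPoly N a (t + 1) = trigPoly N a t := by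
  simp [trigPoly, fourierMode_add_one]

lemma map_trigPoly (Q : E →L[ℂ] E) (N : ℤ) (a : ℤ → E) (t : ℝ) :
    Q (trigPoly N a t) = trigPoly N (fun k => Q (a k)) t := by
  simp [trigPoly]

lemma hasDerivAt_trigPoly (N : ℤ) (a : ℤ → E) (t : ℝ) :
    HasDerivAt (trigPoly N a)
      (Complex.I • trigPoly N (fun k => ((2 * π * k : ℝ) : ℂ) • a k) t) t := by
  have : HasDerivAt (fun t => ∑ k ∈ Finset.Icc (-N) N, fourierMode k t • a k)
      (∑ k ∈ Finset.Icc (-N) N, (2 * π * k * Complex.I * fourierMode k t) • a k) t :=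
    HasDerivAt.fun_sum fun k _ => (hasDerivAt_fourierMode k t).smul_const (a k)
  refine this.congr_deriv ?_
  rw [trigPoly, Finset.smul_sum]
  refine Finset.sum_congr rfl fun k _ => ?_
  rw [smul_smul, smul_smul]
  congr 1
  push_cast; ring

lemma integral_inner_trigPoly (N : ℤ) (a b : ℤ → E) :
    ∫ t in (0 : ℝ)..1, inner ℂ (trigPoly N a t) (trigPoly N b t)
      = ∑ k ∈ Finset.Icc (-N) N, inner ℂ (a k) (b k) := by
  have h : ∀ t, inner ℂ (trigPoly N a t) (trigPoly N b t) =
      ∑ j ∈ Finset.Icc (-N) N, ∑ k ∈ Finset.Icc (-N) N,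
        fourierMode (k - j) t * inner ℂ (a j) (b k) := by
    intro t
    simp only [trigPoly, sum_inner]
    simp only [inner_sum, inner_smul_left, inner_smul_right]
    refine Finset.sum_congr rfl fun j _ => Finset.sum_congr rfl fun k _ => ?_
    rw [conj_fourierMode, sub_eq_add_neg, fourierMode_add]; ring
  simp_rw [h]
  rw [intervalIntegral.integral_finsetSum fun j _ => by
    apply Continuous.intervalIntegrable; fun_prop]
  refine Finset.sum_congr rfl fun j hj => ?_
  rw [intervalIntegral.integral_finsetSum fun j _ => by
    apply Continuous.intervalIntegrable; fun_prop]
  simp only [intervalIntegral.integral_mul_const, integral_fourierMode, sub_eq_zero]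
  simp [hj]

lemma integral_rinner_trigPoly (N : ℤ) (a b : ℤ → E) :
    ∫ t in (0 : ℝ)..1, rinner (trigPoly N a t) (trigPoly N b t)
      = ∑ k ∈ Finset.Icc (-N) N, rinner (a k) (b k) := by
  have h := congrArg Complex.re (integral_inner_trigPoly N a b)
  rw [Complex.re_sum] at h
  refine Eq.trans ?_ h
  exact intervalIntegral.intervalIntegral_re (𝕜 := ℂ)
    (((continuous_trigPoly N a).inner (continuous_trigPoly N b)).intervalIntegrable _ _)

lemma integral_norm_sq_trigPoly (N : ℤ) (a : ℤ → E) :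
    ∫ t in (0 : ℝ)..1, ‖trigPoly N a t‖ ^ 2 = ∑ k ∈ Finset.Icc (-N) N, ‖a k‖ ^ 2 := by
  simpa only [rinner_self] using integral_rinner_trigPoly N a a

/-- The `k`-th Fourier coefficient of a loop. -/
def loopCoeff (w : ℝ → E) (k : ℤ) : E := ∫ t in (0 : ℝ)..1, fourierMode (-k) t • w t

lemma rinner_loopCoeff [CompleteSpace E] {w : ℝ → E} (hw : Continuous w) (k : ℤ) (v : E) :
    rinner (loopCoeff w k) v = ∫ t in (0 : ℝ)..1, rinner (w t) (fourierMode k t • v) := by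
  rw [rinner_comm, loopCoeff, rinner]
  have h1 := ((innerSL ℂ v).intervalIntegral_comp_comm
    (((continuous_fourierMode (-k)).smul hw).intervalIntegrable (μ := MeasureTheory.volume) 0 1))
  have h2 := intervalIntegral.intervalIntegral_re (𝕜 := ℂ) (μ := MeasureTheory.volume)
    (f := fun t => innerSL ℂ v (fourierMode (-k) t • w t)) (a := 0) (b := 1)
    (Continuous.intervalIntegrable (by fun_prop) _ _)
  refine (h2.trans (congrArg Complex.re h1)).symm.trans ?_
  refine intervalIntegral.integral_congr fun t _ => ?_
  simp only [innerSL_apply_apply, inner_smul_right]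
  rw [rinner_comm, rinner, inner_smul_left, conj_fourierMode]
  rfl

lemma sum_rinner_loopCoeff [CompleteSpace E] {w : ℝ → E} (hw : Continuous w) (N : ℤ) (b : ℤ → E) :
    ∑ k ∈ Finset.Icc (-N) N, rinner (loopCoeff w k) (b k)
      = ∫ t in (0 : ℝ)..1, rinner (w t) (trigPoly N b t) := by
  simp_rw [rinner_loopCoeff hw]
  rw [← intervalIntegral.integral_finsetSum fun k _ =>
    Continuous.intervalIntegrable (by fun_prop) _ _]
  refine intervalIntegral.integral_congr fun t _ => ?_
  simp only [rinner, trigPoly, inner_sum, Complex.re_sum]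

lemma sum_inv_mul_inv_le_one (N l : ℤ) :
    ∑ j ∈ Finset.Icc 1 N, ∑ k ∈ Finset.Icc 1 N,
      (if j + k = l then ((j : ℝ) * k)⁻¹ else 0) ≤ 1 := by
  have h1 : ∀ j ∈ Finset.Icc 1 N, ∑ k ∈ Finset.Icc 1 N,
      (if j + k = l then ((j : ℝ) * k)⁻¹ else 0) ≤
        if j ∈ Finset.Icc 1 (l - 1) then ((l - 1 : ℤ) : ℝ)⁻¹ else 0 := by
    intro j hj
    rw [Finset.mem_Icc] at hj
    have h2 : ∀ k ∈ Finset.Icc 1 N, (if j + k = l then ((j : ℝ) * k)⁻¹ else 0) =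
        if k = l - j then ((j : ℝ) * k)⁻¹ else 0 := fun k _ => by
      congr 1; rw [eq_iff_iff]; omega
    rw [Finset.sum_congr rfl h2, Finset.sum_ite_eq']
    by_cases h : l - j ∈ Finset.Icc 1 N
    · rw [if_pos h]
      rw [Finset.mem_Icc] at h
      rw [if_pos (Finset.mem_Icc.2 ⟨hj.1, by omega⟩)]
      have h3 : (1 : ℝ) ≤ j := by exact_mod_cast hj.1
      have h4 : (1 : ℝ) ≤ ((l - j : ℤ) : ℝ) := by exact_mod_cast h.1
      have h5 : (0 : ℝ) < ((l - 1 : ℤ) : ℝ) := by exact_mod_cast (by omega)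
      apply inv_anti₀ h5
      push_cast at h4 ⊢
      nlinarith
    · rw [if_neg h]
      split_ifs with h6
      · rw [Finset.mem_Icc] at h6
        have : (0 : ℝ) ≤ ((l - 1 : ℤ) : ℝ) := by exact_mod_cast (by omega)
        positivity
      · exact le_rfl
  refine (Finset.sum_le_sum h1).trans ?_
  rw [← Finset.sum_filter, Finset.sum_const, nsmul_eq_mul]
  rcases le_or_gt (l - 1) 0 with hl | hl
  · have : (Finset.filter (fun j => j ∈ Finset.Icc 1 (l - 1)) (Finset.Icc 1 N)) = ∅ := by
      ext j; simp; omega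
    rw [this]; simp
  · have hl' : (0 : ℝ) < ((l - 1 : ℤ) : ℝ) := by exact_mod_cast hl
    rw [← div_eq_mul_inv, div_le_one hl']
    have h7 : (Finset.filter (fun j => j ∈ Finset.Icc 1 (l - 1)) (Finset.Icc 1 N)).card
        ≤ (Finset.Icc 1 (l - 1)).card :=
      Finset.card_le_card fun j hj => (Finset.mem_filter.1 hj).2
    rw [Int.card_Icc] at h7
    have h8 : ((Finset.filter (fun j => j ∈ Finset.Icc 1 (l - 1)) (Finset.Icc 1 N)).card : ℤ)
        ≤ l - 1 := by omega
    exact_mod_cast h8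

lemma quadruple_sum_le (N : ℤ) (α : ℤ → ℝ) :
    ∑ i ∈ Finset.Icc 1 N, ∑ j ∈ Finset.Icc 1 N, ∑ k ∈ Finset.Icc 1 N, ∑ l ∈ Finset.Icc 1 N,
      (if i + j = k + l then α i * α j * (α k * α l) else 0)
      ≤ (∑ k ∈ Finset.Icc 1 N, k * α k ^ 2) ^ 2 := by
  set S := Finset.Icc (1 : ℤ) N
  let X : ℤ → ℤ → ℝ := fun i j => (i * α i ^ 2) * (j * α j ^ 2)
  let Y : ℤ → ℤ → ℤ → ℤ → ℝ := fun i j k l => if i + j = k + l then ((k : ℝ) * l)⁻¹ else 0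
  have hX : ∑ i ∈ S, ∑ j ∈ S, X i j = (∑ k ∈ S, k * α k ^ 2) ^ 2 := by
    rw [sq, Finset.sum_mul_sum]
  have hX0 : ∀ i ∈ S, ∀ j ∈ S, 0 ≤ X i j := by
    intro i hi j hj
    have h1 : (0 : ℝ) ≤ i := by exact_mod_cast (by have := (Finset.mem_Icc.1 hi).1; omega)
    have h2 : (0 : ℝ) ≤ j := by exact_mod_cast (by have := (Finset.mem_Icc.1 hj).1; omega)
    positivity
  have hterm : ∀ i ∈ S, ∀ j ∈ S, ∀ k ∈ S, ∀ l ∈ S,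
      (if i + j = k + l then α i * α j * (α k * α l) else 0)
        ≤ (X i j * Y i j k l + X k l * Y k l i j) / 2 := by
    intro i hi j hj k hk l hl
    by_cases h : i + j = k + l
    · simp only [X, Y, h, if_true]
      have hi' : (0 : ℝ) < i := by exact_mod_cast (by have := (Finset.mem_Icc.1 hi).1; omega)
      have hj' : (0 : ℝ) < j := by exact_mod_cast (by have := (Finset.mem_Icc.1 hj).1; omega)
      have hk' : (0 : ℝ) < k := by exact_mod_cast (by have := (Finset.mem_Icc.1 hk).1; omega)
      have hl' : (0 : ℝ) < l := by exact_mod_cast (by have := (Finset.mem_Icc.1 hl).1; omega)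
      set P := (i : ℝ) * j with hP
      set R := (k : ℝ) * l with hR
      have hP0 : 0 < P := by positivity
      have hR0 : 0 < R := by positivity
      have e : (i * α i ^ 2 * (j * α j ^ 2) * R⁻¹ + k * α k ^ 2 * (l * α l ^ 2) * P⁻¹) / 2
          - α i * α j * (α k * α l)
          = (P * (α i * α j) - R * (α k * α l)) ^ 2 / (2 * P * R) := by
        field_simp
        rw [hP, hR]; ring
      have : 0 ≤ (P * (α i * α j) - R * (α k * α l)) ^ 2 / (2 * P * R) := by positivity
      linarith
    · have h' : ¬ k + l = i + j := fun h' => h h'.symm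
      simp [Y, h, h']
  have hY : ∀ i j : ℤ, ∑ k ∈ S, ∑ l ∈ S, Y i j k l ≤ 1 := fun i j => by
    refine le_trans (le_of_eq ?_) (sum_inv_mul_inv_le_one N (i + j))
    refine Finset.sum_congr rfl fun k _ => Finset.sum_congr rfl fun l _ => ?_
    simp only [Y, eq_comm]
  have h1 : ∑ i ∈ S, ∑ j ∈ S, ∑ k ∈ S, ∑ l ∈ S, X i j * Y i j k l ≤ ∑ i ∈ S, ∑ j ∈ S, X i j := by
    refine Finset.sum_le_sum fun i hi => Finset.sum_le_sum fun j hj => ?_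
    simp_rw [← Finset.mul_sum]
    exact mul_le_of_le_one_right (hX0 i hi j hj) (hY i j)
  have h2 : ∑ i ∈ S, ∑ j ∈ S, ∑ k ∈ S, ∑ l ∈ S, X k l * Y k l i j
      = ∑ i ∈ S, ∑ j ∈ S, ∑ k ∈ S, ∑ l ∈ S, X i j * Y i j k l := by
    have hs : ∀ f : ℤ → ℤ → ℤ → ℤ → ℝ, ∑ i ∈ S, ∑ j ∈ S, ∑ k ∈ S, ∑ l ∈ S, f i j k l
        = ∑ p ∈ S ×ˢ S, ∑ q ∈ S ×ˢ S, f p.1 p.2 q.1 q.2 := fun f => by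
      simp only [Finset.sum_product]
    rw [hs, hs fun i j k l => X i j * Y i j k l, Finset.sum_comm]
  calc _ ≤ ∑ i ∈ S, ∑ j ∈ S, ∑ k ∈ S, ∑ l ∈ S, (X i j * Y i j k l + X k l * Y k l i j) / 2 :=
        Finset.sum_le_sum fun i hi => Finset.sum_le_sum fun j hj =>
          Finset.sum_le_sum fun k hk => Finset.sum_le_sum fun l hl => hterm i hi j hj k hk l hl
    _ = (∑ i ∈ S, ∑ j ∈ S, ∑ k ∈ S, ∑ l ∈ S, X i j * Y i j k l
          + ∑ i ∈ S, ∑ j ∈ S, ∑ k ∈ S, ∑ l ∈ S, X k l * Y k l i j) / 2 := by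
        simp only [← Finset.sum_add_distrib, Finset.sum_div]
    _ ≤ _ := by rw [h2, ← hX]; linarith

/-- The embedding of `H^{1/2}` into `L⁴` for trigonometric polynomials with positive frequencies. -/
lemma integral_norm_pow_four_le (N : ℤ) (a : ℤ → E) :
    ∫ t in (0 : ℝ)..1, ‖∑ k ∈ Finset.Icc 1 N, fourierMode k t • a k‖ ^ 4
      ≤ (∑ k ∈ Finset.Icc 1 N, k * ‖a k‖ ^ 2) ^ 2 := by
  refine le_trans ?_ (quadruple_sum_le N fun k => ‖a k‖)
  set S := Finset.Icc (1 : ℤ) N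
  have hpt : ∀ t, ((‖∑ k ∈ S, fourierMode k t • a k‖ ^ 4 : ℝ) : ℂ) =
      ∑ i ∈ S, ∑ j ∈ S, ∑ k ∈ S, ∑ l ∈ S,
        fourierMode (i + j - (k + l)) t * (inner ℂ (a k) (a i) * inner ℂ (a l) (a j)) := by
    intro t
    have h1 : ((‖∑ k ∈ S, fourierMode k t • a k‖ ^ 2 : ℝ) : ℂ) =
        ∑ i ∈ S, ∑ k ∈ S, fourierMode (i - k) t * inner ℂ (a k) (a i) := by
      have := inner_self_eq_norm_sq_to_K (𝕜 := ℂ) (∑ k ∈ S, fourierMode k t • a k)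
      rw [inner_sum] at this
      push_cast
      refine Eq.trans this.symm ?_
      refine Finset.sum_congr rfl fun i _ => ?_
      rw [sum_inner]
      refine Finset.sum_congr rfl fun k _ => ?_
      rw [inner_smul_left, inner_smul_right, conj_fourierMode, sub_eq_add_neg, fourierMode_add]
      ring
    have h2 : ((‖∑ k ∈ S, fourierMode k t • a k‖ ^ 4 : ℝ) : ℂ) =
        ((‖∑ k ∈ S, fourierMode k t • a k‖ ^ 2 : ℝ) : ℂ) *
        ((‖∑ k ∈ S, fourierMode k t • a k‖ ^ 2 : ℝ) : ℂ) := by push_cast; ring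
    rw [h2, h1, Finset.sum_mul_sum]
    refine Finset.sum_congr rfl fun i _ => Finset.sum_congr rfl fun j _ => ?_
    rw [Finset.sum_mul_sum]
    refine Finset.sum_congr rfl fun k _ => Finset.sum_congr rfl fun l _ => ?_
    rw [show i + j - (k + l) = (i - k) + (j - l) by ring, fourierMode_add]
    ring
  have hint : ((∫ t in (0 : ℝ)..1, ‖∑ k ∈ S, fourierMode k t • a k‖ ^ 4 : ℝ) : ℂ) =
      ∑ i ∈ S, ∑ j ∈ S, ∑ k ∈ S, ∑ l ∈ S,
        if i + j = k + l then inner ℂ (a k) (a i) * inner ℂ (a l) (a j) else 0 := by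
    rw [← intervalIntegral.integral_ofReal]
    simp_rw [hpt]
    rw [intervalIntegral.integral_finsetSum fun _ _ => Continuous.intervalIntegrable (by fun_prop) _ _]
    refine Finset.sum_congr rfl fun i _ => ?_
    rw [intervalIntegral.integral_finsetSum fun _ _ => Continuous.intervalIntegrable (by fun_prop) _ _]
    refine Finset.sum_congr rfl fun j _ => ?_
    rw [intervalIntegral.integral_finsetSum fun _ _ => Continuous.intervalIntegrable (by fun_prop) _ _]
    refine Finset.sum_congr rfl fun k _ => ?_
    rw [intervalIntegral.integral_finsetSum fun _ _ => Continuous.intervalIntegrable (by fun_prop) _ _]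
    refine Finset.sum_congr rfl fun l _ => ?_
    rw [intervalIntegral.integral_mul_const, integral_fourierMode]
    simp only [sub_eq_zero, ite_mul, one_mul, zero_mul]
  have hnn : 0 ≤ ∫ t in (0 : ℝ)..1, ‖∑ k ∈ S, fourierMode k t • a k‖ ^ 4 :=
    intervalIntegral.integral_nonneg zero_le_one fun _ _ => by positivity
  rw [← abs_of_nonneg hnn, ← Real.norm_eq_abs, ← Complex.norm_real, hint]
  refine (norm_sum_le _ _).trans (Finset.sum_le_sum fun i _ => ?_)
  refine (norm_sum_le _ _).trans (Finset.sum_le_sum fun j _ => ?_)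
  refine (norm_sum_le _ _).trans (Finset.sum_le_sum fun k _ => ?_)
  refine (norm_sum_le _ _).trans (Finset.sum_le_sum fun l _ => ?_)
  split_ifs with h
  · rw [norm_mul]
    calc _ ≤ (‖a k‖ * ‖a i‖) * (‖a l‖ * ‖a j‖) := by
          gcongr <;> exact norm_inner_le_norm _ _
      _ = _ := by ring
  · simp

end FourierModes

section Galerkin

variable {E : Type*} [NormedAddCommGroup E] [InnerProductSpace ℂ E]

/-- A nonnegative continuous function `H` with a continuous gradient `g` that is semiconvex and
asymptotically linear, with the linear part `Q` of the gradient. -/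
structure TameHamiltonian (H : E → ℝ) (g : E → E) (Q : E →L[ℂ] E) (C : ℝ) : Prop where
  continuous_ham : Continuous H
  continuous_grad : Continuous g
  nonneg : ∀ z, 0 ≤ H z
  const_pos : 0 < C
  semiconvex : ∀ z w, H z + rinner (g z) w - C * ‖w‖ ^ 2 ≤ H (z + w)
  norm_grad_sub_le : ∀ z, ‖g z - Q z‖ ≤ C
  quadratic_le : ∀ z, 1 / 2 * rinner (Q z) z - C ≤ H z

/-- The action functional restricted to trigonometric polynomials of degree `N`. -/
def galerkinAction (H : E → ℝ) (N : ℤ) (a : ℤ → E) : ℝ :=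
  π * ∑ k ∈ Finset.Icc (-N) N, k * ‖a k‖ ^ 2 - ∫ t in (0 : ℝ)..1, H (trigPoly N a t)

/-- The gradient of `galerkinAction`. -/
def galerkinGrad (g : E → E) (N : ℤ) (a : ℤ → E) (k : ℤ) : E :=
  if k ∈ Finset.Icc (-N) N then
    ((2 * π * k : ℝ) : ℂ) • a k - loopCoeff (fun t => g (trigPoly N a t)) k
  else 0

lemma continuous_uncurry_trigPoly (N : ℤ) :
    Continuous fun p : (ℤ → E) × ℝ => trigPoly N p.1 p.2 := by
  unfold trigPoly; fun_prop

lemma continuous_galerkinAction {H : E → ℝ} (hH : Continuous H) (N : ℤ) :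
    Continuous (galerkinAction H N) := by
  unfold galerkinAction
  refine Continuous.sub (by fun_prop) ?_
  exact intervalIntegral.continuous_parametric_intervalIntegral_of_continuous'
    (f := fun (a : ℤ → E) t => H (trigPoly N a t)) (hH.comp (continuous_uncurry_trigPoly N)) 0 1

lemma continuous_galerkinGrad {g : E → E} (hg : Continuous g) (N : ℤ) :
    Continuous (galerkinGrad g N) := by
  refine continuous_pi fun k => ?_
  unfold galerkinGrad
  split_ifs with h
  · refine Continuous.sub (by fun_prop) ?_
    unfold loopCoeff
    refine intervalIntegral.continuous_parametric_intervalIntegral_of_continuous'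
      (f := fun (a : ℤ → E) t => fourierMode (-k) t • g (trigPoly N a t)) ?_ 0 1
    have := hg.comp (continuous_uncurry_trigPoly (E := E) N)
    exact Continuous.smul (by fun_prop) this
  · fun_prop

namespace TameHamiltonian

variable {H : E → ℝ} {g : E → E} {Q : E →L[ℂ] E} {C : ℝ}

lemma galerkinAction_add_le [CompleteSpace E] (hH : TameHamiltonian H g Q C) (N : ℤ)
    (a v : ℤ → E) :
    galerkinAction H N (a + v) ≤ galerkinAction H N a
      + ∑ k ∈ Finset.Icc (-N) N, rinner (galerkinGrad g N a k) (v k)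
      + (π * N + C) * ∑ k ∈ Finset.Icc (-N) N, ‖v k‖ ^ 2 := by
  have hc := hH.continuous_ham
  have hg := hH.continuous_grad
  have h1 : ∫ t in (0 : ℝ)..1, (H (trigPoly N a t) + rinner (g (trigPoly N a t)) (trigPoly N v t)
      - C * ‖trigPoly N v t‖ ^ 2) ≤ ∫ t in (0 : ℝ)..1, H (trigPoly N (a + v) t) := by
    refine intervalIntegral.integral_mono_on zero_le_one
      (Continuous.intervalIntegrable (by fun_prop) _ _)
      (Continuous.intervalIntegrable (by fun_prop) _ _) fun t _ => ?_
    rw [trigPoly_add]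
    exact hH.semiconvex _ _
  rw [intervalIntegral.integral_sub (Continuous.intervalIntegrable (by fun_prop) _ _)
    (Continuous.intervalIntegrable (by fun_prop) _ _),
    intervalIntegral.integral_add (Continuous.intervalIntegrable (by fun_prop) _ _)
    (Continuous.intervalIntegrable (by fun_prop) _ _), intervalIntegral.integral_const_mul,
    integral_norm_sq_trigPoly, ← sum_rinner_loopCoeff (by fun_prop)] at h1
  have h2 : ∑ k ∈ Finset.Icc (-N) N, rinner (galerkinGrad g N a k) (v k) =
      ∑ k ∈ Finset.Icc (-N) N, 2 * π * k * rinner (a k) (v k) -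
      ∑ k ∈ Finset.Icc (-N) N, rinner (loopCoeff (fun t => g (trigPoly N a t)) k) (v k) := by
    rw [← Finset.sum_sub_distrib]
    refine Finset.sum_congr rfl fun k hk => ?_
    rw [galerkinGrad, if_pos hk, rinner_sub_left, rinner_smul_left]
  have h3 : π * ∑ k ∈ Finset.Icc (-N) N, (k : ℝ) * ‖(a + v) k‖ ^ 2 ≤
      π * ∑ k ∈ Finset.Icc (-N) N, (k : ℝ) * ‖a k‖ ^ 2 +
      ∑ k ∈ Finset.Icc (-N) N, 2 * π * k * rinner (a k) (v k) +
      π * N * ∑ k ∈ Finset.Icc (-N) N, ‖v k‖ ^ 2 := by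
    simp only [Finset.mul_sum]
    rw [← Finset.sum_add_distrib, ← Finset.sum_add_distrib]
    refine Finset.sum_le_sum fun k hk => ?_
    rw [Pi.add_apply, norm_add_sq_rinner]
    have hk' : (k : ℝ) ≤ N := by exact_mod_cast (Finset.mem_Icc.1 hk).2
    have := mul_le_mul_of_nonneg_right hk' (mul_nonneg pi_pos.le (sq_nonneg ‖v k‖))
    nlinarith
  rw [galerkinAction, galerkinAction, h2]
  linarith

/-- The squared norm of the gradient of the restricted action. -/
def _root_.galerkinGradSq (g : E → E) (N : ℤ) (a : ℤ → E) : ℝ :=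
  ∑ k ∈ Finset.Icc (-N) N, ‖galerkinGrad g N a k‖ ^ 2

/-- The cut-off factor of the gradient step. -/
def _root_.stepCutoff (α s : ℝ) : ℝ := max 0 (min (s / α) 1)

/-- The cut-off gradient step decreasing the restricted action. -/
def _root_.gradientStep (H : E → ℝ) (g : E → E) (C α : ℝ) (N : ℤ) (a : ℤ → E) : ℤ → E :=
  fun k => a k + ((-(stepCutoff α (galerkinAction H N a) / (2 * (π * N + C))) : ℝ) : ℂ) •
    galerkinGrad g N a k

lemma continuous_gradientStep (hH : TameHamiltonian H g Q C) (α : ℝ) (N : ℤ) :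
    Continuous (gradientStep H g C α N) := by
  have h1 := continuous_galerkinAction hH.continuous_ham N
  have h2 := continuous_galerkinGrad hH.continuous_grad N
  refine continuous_pi fun k => ?_
  have h3 : Continuous fun a => galerkinGrad g N a k := (continuous_apply k).comp h2
  unfold gradientStep stepCutoff
  fun_prop

lemma gradientStep_eq_self {α : ℝ} (hα : 0 < α) {N : ℤ} {a : ℤ → E}
    (ha : galerkinAction H N a ≤ 0) : gradientStep H g C α N a = a := by
  have : stepCutoff α (galerkinAction H N a) = 0 := by
    rw [stepCutoff, max_eq_left]
    exact (min_le_left _ _).trans (div_nonpos_of_nonpos_of_nonneg ha hα.le)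
  ext k
  simp [gradientStep, this]

lemma galerkinAction_gradientStep_le [CompleteSpace E] (hH : TameHamiltonian H g Q C) (α : ℝ)
    {N : ℤ} (hN : 0 ≤ N) (a : ℤ → E) :
    galerkinAction H N (gradientStep H g C α N a) ≤ galerkinAction H N a
      - stepCutoff α (galerkinAction H N a) / (4 * (π * N + C)) * galerkinGradSq g N a := by
  set χ := stepCutoff α (galerkinAction H N a)
  set L := π * N + C with hL
  have hN' : (0 : ℝ) ≤ N := by exact_mod_cast hN
  have hL0 : 0 < L := by have := hH.const_pos; positivity
  have hχ0 : 0 ≤ χ := le_max_left _ _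
  have hχ1 : χ ≤ 1 := max_le zero_le_one (min_le_right _ _)
  have h := hH.galerkinAction_add_le N a
    (fun k => ((-(χ / (2 * L)) : ℝ) : ℂ) • galerkinGrad g N a k)
  have hS : 0 ≤ galerkinGradSq g N a := Finset.sum_nonneg fun _ _ => by positivity
  simp only [rinner_smul_right, rinner_self, norm_smul, Complex.norm_real, mul_pow,
    ← Finset.mul_sum, Real.norm_eq_abs, sq_abs] at h
  change galerkinAction H N (gradientStep H g C α N a) ≤ _ + _ * galerkinGradSq g N a +
    L * (_ * galerkinGradSq g N a) at h
  refine h.trans ?_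
  have h4 : galerkinAction H N a + -(χ / (2 * L)) * galerkinGradSq g N a +
      L * ((-(χ / (2 * L))) ^ 2 * galerkinGradSq g N a) =
      galerkinAction H N a - χ / (4 * L) * galerkinGradSq g N a
        - χ * (1 - χ) / (4 * L) * galerkinGradSq g N a := by
    field_simp; ring
  rw [h4]
  have : 0 ≤ χ * (1 - χ) / (4 * L) * galerkinGradSq g N a := by
    have : 0 ≤ 1 - χ := by linarith
    positivity
  linarith

/-- If the gradient is bounded below on a slab, some iterate of the gradient step pushes the
sublevel set of the upper value below the lower value. -/
lemma exists_iterate_gradientStep_lt [CompleteSpace E] (hH : TameHamiltonian H g Q C) {α β δ : ℝ}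
    (hα : 0 < α) (hδ : 0 < δ) {N : ℤ} (hN : 0 ≤ N)
    (h : ∀ a, α ≤ galerkinAction H N a → galerkinAction H N a ≤ β → δ ≤ galerkinGradSq g N a) :
    ∃ n : ℕ, ∀ a, galerkinAction H N a ≤ β →
      galerkinAction H N ((gradientStep H g C α N)^[n] a) < α := by
  have hN' : (0 : ℝ) ≤ N := by exact_mod_cast hN
  have hL0 : 0 < 4 * (π * N + C) := by have := hH.const_pos; positivity
  set μ := δ / (4 * (π * N + C)) with hμ
  have hμ0 : 0 < μ := by positivity
  have key : ∀ n : ℕ, ∀ a, galerkinAction H N a ≤ β →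
      galerkinAction H N ((gradientStep H g C α N)^[n] a) < α ∨
      galerkinAction H N ((gradientStep H g C α N)^[n] a) ≤ β - n * μ := by
    intro n a ha
    induction n with
    | zero => right; simpa using ha
    | succ n ih =>
      rw [Function.iterate_succ_apply']
      set b := (gradientStep H g C α N)^[n] a
      have hd := hH.galerkinAction_gradientStep_le α hN b
      have hS : 0 ≤ galerkinGradSq g N b := Finset.sum_nonneg fun _ _ => by positivity
      have hχ0 : 0 ≤ stepCutoff α (galerkinAction H N b) := le_max_left _ _
      rcases lt_or_ge (galerkinAction H N b) α with hb | hb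
      · left
        have : 0 ≤ stepCutoff α (galerkinAction H N b) / (4 * (π * N + C)) *
          galerkinGradSq g N b := by positivity
        linarith
      · right
        have hb' := ih.resolve_left (not_lt.2 hb)
        have h1 : stepCutoff α (galerkinAction H N b) = 1 := by
          rw [stepCutoff, min_eq_right ((one_le_div hα).2 hb), max_eq_right zero_le_one]
        have h2 := h b hb (hb'.trans (by have : 0 ≤ (n : ℝ) * μ := by positivity
                                         linarith))
        rw [h1] at hd
        have h3 : μ ≤ 1 / (4 * (π * N + C)) * galerkinGradSq g N b := by
          rw [hμ, one_div_mul_eq_div]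
          gcongr
        push_cast
        linarith
  obtain ⟨n, hn⟩ := exists_nat_gt ((β - α) / μ)
  refine ⟨n, fun a ha => (key n a ha).elim id fun h' => ?_⟩
  rw [div_lt_iff₀ hμ0] at hn
  linarith

end TameHamiltonian

end Galerkin

section Linking

variable {E : Type*} [NormedAddCommGroup E] [InnerProductSpace ℂ E]

/-- The coefficients with the nonpositive part `w.1` and with `w.2 • e` at frequency one. -/
def linkingEmbedding (e : E) (N : ℤ) (w : (Finset.Icc (-N) 0 → E) × ℝ) (k : ℤ) : E :=
  if h : k ∈ Finset.Icc (-N) 0 then w.1 ⟨k, h⟩ else if k = 1 then (w.2 : ℂ) • e else 0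

/-- The `H^{1/2}` seminorm of the part with positive frequencies. -/
def positiveSeminorm (N : ℤ) (a : ℤ → E) : ℝ := √(∑ k ∈ Finset.Icc 1 N, k * ‖a k‖ ^ 2)

lemma sum_Icc_neg_eq_add {M : Type*} [AddCommMonoid M] {N : ℤ} (hN : 0 ≤ N) (f : ℤ → M) :
    ∑ k ∈ Finset.Icc (-N) N, f k = ∑ k ∈ Finset.Icc (-N) 0, f k + ∑ k ∈ Finset.Icc 1 N, f k := by
  have : Finset.Icc (-N) N = Finset.Icc (-N) 0 ∪ Finset.Icc 1 N := by
    ext k; simp only [Finset.mem_union, Finset.mem_Icc]; omega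
  rw [this, Finset.sum_union]
  rw [Finset.disjoint_left]
  intro k; simp only [Finset.mem_Icc]; omega

lemma continuous_linkingEmbedding (e : E) (N : ℤ) : Continuous (linkingEmbedding e N) := by
  refine continuous_pi fun k => ?_
  unfold linkingEmbedding
  split_ifs <;> fun_prop

omit [InnerProductSpace ℂ E] in
lemma continuous_positiveSeminorm (N : ℤ) : Continuous (positiveSeminorm (E := E) N) := by
  unfold positiveSeminorm; fun_prop

lemma linkingEmbedding_of_mem (e : E) {N k : ℤ} (w : (Finset.Icc (-N) 0 → E) × ℝ)
    (hk : k ∈ Finset.Icc (-N) 0) : linkingEmbedding e N w k = w.1 ⟨k, hk⟩ := by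
  rw [linkingEmbedding, dif_pos hk]

lemma sum_linkingEmbedding {M : Type*} [AddCommMonoid M] {e : E} {N : ℤ} (hN : 1 ≤ N)
    (w : (Finset.Icc (-N) 0 → E) × ℝ) (f : ℤ → E → M) (hf : ∀ k, f k 0 = 0) :
    ∑ k ∈ Finset.Icc (-N) N, f k (linkingEmbedding e N w k) =
      ∑ k : Finset.Icc (-N) 0, f k (w.1 k) + f 1 ((w.2 : ℂ) • e) := by
  rw [sum_Icc_neg_eq_add (by omega)]
  congr 1
  · rw [← Finset.sum_coe_sort]
    refine Finset.sum_congr rfl fun k _ => ?_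
    rw [linkingEmbedding_of_mem e w k.2]
  · rw [Finset.sum_eq_single 1]
    · rw [linkingEmbedding, dif_neg (by simp), if_pos rfl]
    · intro k hk hk1
      rw [linkingEmbedding, dif_neg (by simp at hk ⊢; omega), if_neg hk1, hf]
    · intro h; simp at h; omega

lemma positiveSeminorm_linkingEmbedding {e : E} (he : ‖e‖ = 1) {N : ℤ} (hN : 1 ≤ N)
    (w : (Finset.Icc (-N) 0 → E) × ℝ) :
    positiveSeminorm N (linkingEmbedding e N w) = |w.2| := by
  rw [positiveSeminorm, Finset.sum_eq_single 1]
  · rw [linkingEmbedding, dif_neg (by simp), if_pos rfl, norm_smul, he]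
    simp [Real.sqrt_sq_eq_abs]
  · intro k hk hk1
    rw [linkingEmbedding, dif_neg (by simp at hk ⊢; omega), if_neg hk1]
    simp
  · intro h; simp at h; omega

namespace TameHamiltonian

variable {H : E → ℝ} {g : E → E} {Q : E →L[ℂ] E} {C : ℝ}

lemma galerkinAction_linkingEmbedding_le (hH : TameHamiltonian H g Q C) {e : E} (he : ‖e‖ = 1)
    {κ₁ κ₂ : ℝ} (he' : 1 / 2 * rinner (Q e) e = κ₁)
    (hκ : ∀ v, κ₂ * ‖v‖ ^ 2 ≤ 1 / 2 * rinner (Q v) v) {N : ℤ} (hN : 1 ≤ N)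
    (w : (Finset.Icc (-N) 0 → E) × ℝ) :
    galerkinAction H N (linkingEmbedding e N w) ≤
      C - (κ₁ - π) * w.2 ^ 2 - κ₂ * ∑ k, ‖w.1 k‖ ^ 2 := by
  set a := linkingEmbedding e N w
  have hc := hH.continuous_ham
  have h1 : ∫ t in (0 : ℝ)..1, (1 / 2 * rinner (Q (trigPoly N a t)) (trigPoly N a t) - C) ≤
      ∫ t in (0 : ℝ)..1, H (trigPoly N a t) :=
    intervalIntegral.integral_mono_on zero_le_one
      (Continuous.intervalIntegrable (by fun_prop) _ _)
      (Continuous.intervalIntegrable (by fun_prop) _ _) fun t _ => hH.quadratic_le _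
  rw [intervalIntegral.integral_sub (Continuous.intervalIntegrable (by fun_prop) _ _)
    (Continuous.intervalIntegrable (by fun_prop) _ _), intervalIntegral.integral_const_mul] at h1
  simp_rw [map_trigPoly] at h1
  rw [integral_rinner_trigPoly, sum_linkingEmbedding hN w (fun _ v => rinner (Q v) v)
    (fun _ => by simp [rinner])] at h1
  simp only [intervalIntegral.integral_const, sub_zero, one_smul, map_smul] at h1
  rw [rinner_smul_left, rinner_smul_right] at h1
  have h2 : ∑ k ∈ Finset.Icc (-N) N, (k : ℝ) * ‖a k‖ ^ 2 ≤ w.2 ^ 2 := by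
    rw [sum_linkingEmbedding hN w (fun k v => (k : ℝ) * ‖v‖ ^ 2) (fun _ => by simp)]
    have : ∑ k : Finset.Icc (-N) 0, ((k : ℤ) : ℝ) * ‖w.1 k‖ ^ 2 ≤ 0 :=
      Finset.sum_nonpos fun k _ => mul_nonpos_of_nonpos_of_nonneg
        (by exact_mod_cast (Finset.mem_Icc.1 k.2).2) (sq_nonneg _)
    simp only [norm_smul, he, Complex.norm_real, Real.norm_eq_abs, mul_one, sq_abs]
    push_cast
    linarith
  have h3 := mul_le_mul_of_nonneg_left h2 pi_pos.le
  have h4 : κ₂ * ∑ k, ‖w.1 k‖ ^ 2 ≤ 1 / 2 * ∑ k, rinner (Q (w.1 k)) (w.1 k) := by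
    rw [Finset.mul_sum, Finset.mul_sum]
    exact Finset.sum_le_sum fun k _ => hκ _
  rw [galerkinAction]
  nlinarith

lemma galerkinAction_linkingEmbedding_nonpos (hH : TameHamiltonian H g Q C) {e : E}
    {N : ℤ} (hN : 1 ≤ N) {w : (Finset.Icc (-N) 0 → E) × ℝ} (hw : w.2 = 0) :
    galerkinAction H N (linkingEmbedding e N w) ≤ 0 := by
  have h1 : ∑ k ∈ Finset.Icc (-N) N, (k : ℝ) * ‖linkingEmbedding e N w k‖ ^ 2 ≤ 0 := by
    rw [sum_linkingEmbedding hN w (fun k v => (k : ℝ) * ‖v‖ ^ 2) (fun _ => by simp), hw]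
    have : ∑ k : Finset.Icc (-N) 0, ((k : ℤ) : ℝ) * ‖w.1 k‖ ^ 2 ≤ 0 :=
      Finset.sum_nonpos fun k _ => mul_nonpos_of_nonpos_of_nonneg
        (by exact_mod_cast (Finset.mem_Icc.1 k.2).2) (sq_nonneg _)
    simpa using this
  have h2 : 0 ≤ ∫ t in (0 : ℝ)..1, H (trigPoly N (linkingEmbedding e N w) t) :=
    intervalIntegral.integral_nonneg zero_le_one fun _ _ => hH.nonneg _
  have h3 := mul_nonpos_of_nonneg_of_nonpos pi_pos.le h1
  rw [galerkinAction]
  linarith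

lemma le_galerkinAction (hH : TameHamiltonian H g Q C) {p : E} {C₄ : ℝ}
    (hp : ∀ v, H (p + v) ≤ C₄ * ‖v‖ ^ 4) {N : ℤ} (hN : 1 ≤ N) {a : ℤ → E} (ha0 : a 0 = p)
    (ha : ∀ k ∈ Finset.Icc (-N) 0, k ≠ 0 → a k = 0) (hC₄ : 0 ≤ C₄) :
    π * positiveSeminorm N a ^ 2 - C₄ * positiveSeminorm N a ^ 4 ≤ galerkinAction H N a := by
  have hc := hH.continuous_ham
  have hn : positiveSeminorm N a ^ 2 = ∑ k ∈ Finset.Icc 1 N, (k : ℝ) * ‖a k‖ ^ 2 := by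
    rw [positiveSeminorm, Real.sq_sqrt]
    refine Finset.sum_nonneg fun k hk => ?_
    have : (0 : ℝ) ≤ k := by exact_mod_cast zero_le_one.trans (Finset.mem_Icc.1 hk).1
    positivity
  have h0 : (0 : ℤ) ∈ Finset.Icc (-N) 0 := by simp; omega
  have hsum : ∑ k ∈ Finset.Icc (-N) N, (k : ℝ) * ‖a k‖ ^ 2 = positiveSeminorm N a ^ 2 := by
    rw [sum_Icc_neg_eq_add (by omega), hn, Finset.sum_eq_zero, zero_add]
    intro k hk
    rcases eq_or_ne k 0 with rfl | h
    · simp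
    · simp [ha k hk h]
  have htr : ∀ t, trigPoly N a t = p + ∑ k ∈ Finset.Icc 1 N, fourierMode k t • a k := by
    intro t
    rw [trigPoly, sum_Icc_neg_eq_add (by omega), Finset.sum_eq_single_of_mem 0 h0]
    · rw [fourierMode_zero, one_smul, ha0]
    · intro k hk h
      rw [ha k hk h, smul_zero]
  have h1 : ∫ t in (0 : ℝ)..1, H (trigPoly N a t) ≤
      ∫ t in (0 : ℝ)..1, C₄ * ‖∑ k ∈ Finset.Icc 1 N, fourierMode k t • a k‖ ^ 4 := by
    refine intervalIntegral.integral_mono_on zero_le_one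
      (Continuous.intervalIntegrable (by fun_prop) _ _)
      (Continuous.intervalIntegrable (by fun_prop) _ _) fun t _ => ?_
    rw [htr]
    exact hp _
  rw [intervalIntegral.integral_const_mul] at h1
  have h2 := mul_le_mul_of_nonneg_left (integral_norm_pow_four_le N a) hC₄
  rw [← hn] at h2
  rw [galerkinAction, hsum]
  have : (positiveSeminorm N a ^ 2) ^ 2 = positiveSeminorm N a ^ 4 := by ring
  rw [this] at h2
  linarith

/-- Linking: every iterate of the gradient step keeps a point of the linking family at a definite
positive action. -/
lemma exists_le_galerkinAction_iterate [FiniteDimensional ℂ E] [CompleteSpace E]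
    (hH : TameHamiltonian H g Q C)
    {e : E} (he : ‖e‖ = 1) {κ₁ κ₂ : ℝ} (he' : 1 / 2 * rinner (Q e) e = κ₁) (hκ₁ : π < κ₁)
    (hκ₂ : 0 < κ₂) (hκ : ∀ v, κ₂ * ‖v‖ ^ 2 ≤ 1 / 2 * rinner (Q v) v) {p : E} {C₄ : ℝ}
    (hp : ∀ v, H (p + v) ≤ C₄ * ‖v‖ ^ 4) (hC₄ : 0 ≤ C₄) {α : ℝ} (hα : 0 < α)
    {ρ : ℝ} (hρ : 0 < ρ) {N : ℤ} (hN : 1 ≤ N) (n : ℕ) :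
    ∃ a, galerkinAction H N a ≤ C ∧
      π * ρ ^ 2 - C₄ * ρ ^ 4 ≤ galerkinAction H N ((gradientStep H g C α N)^[n] a) := by
  set W := (Finset.Icc (-N) 0 → E) × ℝ
  set h := (gradientStep H g C α N)^[n]
  have hcont : Continuous h := (hH.continuous_gradientStep α N).iterate n
  have hfix : ∀ a, galerkinAction H N a ≤ 0 → h a = a := fun a ha =>
    Function.iterate_fixed (gradientStep_eq_self hα ha) n
  let ι : W → ℤ → E := fun w => linkingEmbedding e N (w.1, max w.2 0)
  let F : W → W := fun w => (fun k => h (ι w) k, positiveSeminorm N (h (ι w)) + min w.2 0)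
  have hι : Continuous ι := (continuous_linkingEmbedding e N).comp (by fun_prop)
  have hF : Continuous F := by
    refine Continuous.prodMk (continuous_pi fun k => ?_) ?_
    · exact (continuous_apply (k : ℤ)).comp (hcont.comp hι)
    · exact ((continuous_positiveSeminorm N).comp (hcont.comp hι)).add (by fun_prop)
  have hFid : ∀ w : W, galerkinAction H N (ι w) ≤ 0 → F w = w := by
    intro w hw
    ext k
    · change h (ι w) k = w.1 k
      rw [hfix _ hw]
      exact linkingEmbedding_of_mem e _ k.2
    · change positiveSeminorm N (h (ι w)) + min w.2 0 = w.2
      rw [hfix _ hw, positiveSeminorm_linkingEmbedding he hN]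
      change |max w.2 0| + min w.2 0 = w.2
      rw [abs_of_nonneg (le_max_right _ _)]
      have := max_add_min w.2 0
      linarith
  have hneg : ∀ w : W, w.2 ≤ 0 → galerkinAction H N (ι w) ≤ 0 := fun w hw =>
    hH.galerkinAction_linkingEmbedding_nonpos hN (max_eq_right hw)
  set c := min (κ₁ - π) κ₂
  have hc : 0 < c := lt_min (by linarith) hκ₂
  have hbound : ∀ w : W, √(C / c) ≤ ‖w‖ → F w = w := by
    intro w hw
    rcases le_total w.2 0 with h0 | h0
    · exact hFid w (hneg w h0)
    · refine hFid w ((hH.galerkinAction_linkingEmbedding_le he he' hκ hN _).trans ?_)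
      simp only [max_eq_left h0]
      have h1 : ‖w‖ ^ 2 ≤ w.2 ^ 2 + ∑ k, ‖w.1 k‖ ^ 2 := by
        have hs : 0 ≤ ∑ k, ‖w.1 k‖ ^ 2 := Finset.sum_nonneg fun _ _ => sq_nonneg _
        rw [← Real.sqrt_le_sqrt_iff (by positivity), Real.sqrt_sq (norm_nonneg _),
          Prod.norm_def]
        refine max_le ((pi_norm_le_iff_of_nonneg (Real.sqrt_nonneg _)).2 fun k => ?_) ?_
        · refine Real.le_sqrt_of_sq_le ?_
          have := Finset.single_le_sum (f := fun k => ‖w.1 k‖ ^ 2) (fun _ _ => sq_nonneg _)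
            (Finset.mem_univ k)
          nlinarith
        · refine Real.le_sqrt_of_sq_le ?_
          rw [Real.norm_eq_abs, sq_abs]
          linarith
      have h2 : C / c ≤ ‖w‖ ^ 2 := by
        have := pow_le_pow_left₀ (Real.sqrt_nonneg _) hw 2
        rwa [Real.sq_sqrt (div_nonneg hH.const_pos.le hc.le)] at this
      rw [div_le_iff₀ hc] at h2
      have h3 : c * w.2 ^ 2 ≤ (κ₁ - π) * w.2 ^ 2 :=
        mul_le_mul_of_nonneg_right (min_le_left _ _) (sq_nonneg _)
      have h4 : c * ∑ k, ‖w.1 k‖ ^ 2 ≤ κ₂ * ∑ k, ‖w.1 k‖ ^ 2 :=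
        mul_le_mul_of_nonneg_right (min_le_right _ _)
          (Finset.sum_nonneg fun _ _ => sq_nonneg _)
      nlinarith
  obtain ⟨w, hw⟩ := surjective_of_eq_id_outside_bounded hF hbound
    (fun k => if (k : ℤ) = 0 then p else 0, ρ)
  have hw2 : 0 ≤ w.2 := by
    by_contra! hlt
    rw [hFid w (hneg w hlt.le)] at hw
    rw [hw] at hlt
    exact absurd hlt (not_lt.2 hρ.le)
  have hw1 : ∀ k (hk : k ∈ Finset.Icc (-N) 0), h (ι w) k = if k = 0 then p else 0 :=
    fun k hk => congrFun (congrArg Prod.fst hw) ⟨k, hk⟩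
  have hwρ : positiveSeminorm N (h (ι w)) = ρ := by
    have : positiveSeminorm N (h (ι w)) + min w.2 0 = ρ := congrArg Prod.snd hw
    rwa [min_eq_right hw2, add_zero] at this
  refine ⟨ι w, ?_, ?_⟩
  · refine (hH.galerkinAction_linkingEmbedding_le he he' hκ hN _).trans ?_
    have h1 : 0 ≤ (κ₁ - π) * (max w.2 0) ^ 2 := mul_nonneg (by linarith) (sq_nonneg _)
    have h2 : 0 ≤ κ₂ * ∑ k, ‖w.1 k‖ ^ 2 :=
      mul_nonneg hκ₂.le (Finset.sum_nonneg fun _ _ => sq_nonneg _)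
    simp only
    linarith
  · have := hH.le_galerkinAction hp hN (a := h (ι w))
      (by rw [hw1 0 (by simp; omega), if_pos rfl]) (fun k hk h0 => by rw [hw1 k hk, if_neg h0]) hC₄
    rwa [hwρ] at this

/-- Almost critical points of the restricted action at positive levels. -/
lemma exists_galerkinGradSq_lt [FiniteDimensional ℂ E] [CompleteSpace E]
    (hH : TameHamiltonian H g Q C)
    {e : E} (he : ‖e‖ = 1) {κ₁ κ₂ : ℝ} (he' : 1 / 2 * rinner (Q e) e = κ₁) (hκ₁ : π < κ₁)
    (hκ₂ : 0 < κ₂) (hκ : ∀ v, κ₂ * ‖v‖ ^ 2 ≤ 1 / 2 * rinner (Q v) v) {p : E} {C₄ : ℝ}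
    (hp : ∀ v, H (p + v) ≤ C₄ * ‖v‖ ^ 4) (hC₄ : 0 ≤ C₄) :
    ∃ α > 0, ∀ N : ℤ, 1 ≤ N → ∀ δ > 0, ∃ a, α ≤ galerkinAction H N a ∧
      galerkinGradSq g N a < δ := by
  set ρ := √(π / (2 * (C₄ + 1)))
  have hρ : 0 < ρ := Real.sqrt_pos.2 (by positivity)
  have hρ2 : ρ ^ 2 * (2 * (C₄ + 1)) = π := by
    rw [Real.sq_sqrt (by positivity)]; field_simp
  refine ⟨π * ρ ^ 2 - C₄ * ρ ^ 4, ?_, fun N hN δ hδ => ?_⟩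
  · have : 0 < ρ ^ 2 := by positivity
    have h4 : C₄ * ρ ^ 4 = C₄ * ρ ^ 2 * ρ ^ 2 := by ring
    rw [h4, ← hρ2]
    nlinarith [mul_pos this this, mul_nonneg hC₄ (mul_pos this this).le]
  · by_contra! hcon
    set α := π * ρ ^ 2 - C₄ * ρ ^ 4 with hα
    have hα0 : 0 < α := by
      have : 0 < ρ ^ 2 := by positivity
      have h4 : C₄ * ρ ^ 4 = C₄ * ρ ^ 2 * ρ ^ 2 := by ring
      rw [hα, h4, ← hρ2]
      nlinarith [mul_pos this this, mul_nonneg hC₄ (mul_pos this this).le]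
    obtain ⟨n, hn⟩ := hH.exists_iterate_gradientStep_lt hα0 hδ (zero_le_one.trans hN)
      (β := C) fun a ha _ => hcon a ha
    obtain ⟨a, ha, ha'⟩ := hH.exists_le_galerkinAction_iterate he he' hκ₁ hκ₂ hκ hp hC₄ hα0 hρ hN n
    exact absurd (hn a ha) (not_lt.2 ha')

end TameHamiltonian

end Linking

section LoopLimits

open Filter Topology

variable {E : Type*} [NormedAddCommGroup E] [InnerProductSpace ℂ E]

/-- A uniformly bounded sequence of periodic functions with a common Hölder modulus has a
pointwise convergent subsequence. -/
lemma exists_subseq_tendsto_of_periodic [FiniteDimensional ℂ E] {f : ℕ → ℝ → E} {B M : ℝ}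
    (hper : ∀ n t, f n (t + 1) = f n t) (hB : ∀ n t, ‖f n t‖ ≤ B)
    (hM : ∀ n s t, |t - s| ≤ 1 → ‖f n t - f n s‖ ≤ M * √|t - s|) :
    ∃ (φ : ℕ → ℕ) (x : ℝ → E), StrictMono φ ∧ Continuous x ∧ (∀ t, x (t + 1) = x t) ∧
      ∀ t, Tendsto (fun n => f (φ n) t) atTop (𝓝 (x t)) := by
  have : ProperSpace E := FiniteDimensional.proper ℂ E
  have hmod : Tendsto (fun d : ℝ => M * √|d|) (𝓝 0) (𝓝 0) := by
    have : Continuous fun d : ℝ => M * √|d| := by fun_prop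
    simpa using this.tendsto 0
  have hcont : ∀ h : ℝ → E, (∀ s t, |t - s| ≤ 1 → ‖h t - h s‖ ≤ M * √|t - s|) → Continuous h := by
    intro h hh
    refine continuous_iff_continuousAt.2 fun s => ?_
    rw [ContinuousAt, tendsto_iff_norm_sub_tendsto_zero]
    have h1 : Tendsto (fun t : ℝ => t - s) (𝓝 s) (𝓝 0) := by
      have : Continuous fun t : ℝ => t - s := by fun_prop
      simpa using this.tendsto s
    refine squeeze_zero' (Eventually.of_forall fun _ => norm_nonneg _) ?_ (hmod.comp h1)
    filter_upwards [Metric.ball_mem_nhds s one_pos] with t ht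
    exact hh s t (by rw [Metric.mem_ball, Real.dist_eq] at ht; exact ht.le)
  let F : ℕ → BoundedContinuousFunction (Set.Icc (0 : ℝ) 1) E := fun n =>
    BoundedContinuousFunction.mkOfCompact ⟨fun t => f n t, by
      have := hcont (f n) (hM n); fun_prop⟩
  have hcomp : IsCompact (closure (Set.range F)) := by
    refine BoundedContinuousFunction.arzela_ascoli (Metric.closedBall (0 : E) B)
      (isCompact_closedBall _ _) _ ?_ ?_
    · rintro _ t ⟨n, rfl⟩
      rw [mem_closedBall_zero_iff]
      exact hB n t
    · refine Metric.equicontinuous_of_continuity_modulus (fun d => M * √|d|) hmod _ ?_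
      rintro s t ⟨_, n, rfl⟩
      rw [dist_eq_norm, Subtype.dist_eq, Real.dist_eq, abs_abs]
      refine hM n t s ?_
      rw [abs_le]
      constructor <;> linarith [s.2.1, s.2.2, t.2.1, t.2.2]
  obtain ⟨G, -, φ, hφ, hG⟩ := hcomp.tendsto_subseq (x := F) fun n => subset_closure ⟨n, rfl⟩
  have hfract : ∀ n t, f n t = f n (Int.fract t) := fun n t => by
    have hp : Function.Periodic (f n) 1 := hper n
    have := hp.sub_int_mul_eq (x := t) ⌊t⌋
    rw [mul_one] at this
    exact this.symm
  have hlim : ∀ t, Tendsto (fun n => f (φ n) t) atTop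
      (𝓝 (G ⟨Int.fract t, Int.fract_nonneg t, (Int.fract_lt_one t).le⟩)) := fun t => by
    simp_rw [hfract _ t]
    exact ((continuous_eval_const _).tendsto G).comp hG
  refine ⟨φ, _, hφ, hcont _ fun s t hst => ?_, fun t => ?_, hlim⟩
  · exact le_of_tendsto ((hlim t).sub (hlim s)).norm (Eventually.of_forall fun n => hM _ s t hst)
  · exact tendsto_nhds_unique (hlim (t + 1)) (by simpa only [hper] using hlim t)

lemma tendsto_integral_comp_of_bounded [FiniteDimensional ℂ E] {F : Type*} [NormedAddCommGroup F]
    [NormedSpace ℝ F] {ψ : ℝ → E → F} (hψ : Continuous fun p : ℝ × E => ψ p.1 p.2)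
    {f : ℕ → ℝ → E} {x : ℝ → E} {B : ℝ} (hf : ∀ n, Continuous (f n)) (hB : ∀ n t, ‖f n t‖ ≤ B)
    (hx : ∀ t, Tendsto (fun n => f n t) atTop (𝓝 (x t))) :
    Tendsto (fun n => ∫ t in (0 : ℝ)..1, ψ t (f n t)) atTop
      (𝓝 (∫ t in (0 : ℝ)..1, ψ t (x t))) := by
  have : ProperSpace E := FiniteDimensional.proper ℂ E
  obtain ⟨K, hK⟩ := ((isCompact_Icc (a := (0 : ℝ)) (b := 1)).prod
    (isCompact_closedBall (0 : E) B)).exists_bound_of_continuousOn hψ.continuousOn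
  refine intervalIntegral.tendsto_integral_filter_of_dominated_convergence (fun _ => K) ?_ ?_
    (by simp) ?_
  · refine Eventually.of_forall fun n => Continuous.aestronglyMeasurable ?_
    have := hf n
    exact hψ.comp (continuous_id.prodMk this)
  · refine Eventually.of_forall fun n => Eventually.of_forall fun t ht => ?_
    rw [Set.uIoc_of_le zero_le_one] at ht
    exact hK (t, f n t) ⟨⟨ht.1.le, ht.2⟩, by rw [mem_closedBall_zero_iff]; exact hB n t⟩
  · refine Eventually.of_forall fun t _ => ?_
    exact (hψ.tendsto (t, x t)).comp (tendsto_const_nhds.prodMk_nhds (hx t))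

lemma loopCoeff_trigPoly [CompleteSpace E] {N k : ℤ} (hk : k ∈ Finset.Icc (-N) N) (a : ℤ → E) :
    loopCoeff (trigPoly N a) k = a k := by
  have h : ∀ t, fourierMode (-k) t • trigPoly N a t =
      ∑ j ∈ Finset.Icc (-N) N, fourierMode (j - k) t • a j := fun t => by
    rw [trigPoly, Finset.smul_sum]
    refine Finset.sum_congr rfl fun j _ => ?_
    rw [smul_smul, ← fourierMode_add]; congr 2; ring
  rw [loopCoeff]
  simp_rw [h]
  rw [intervalIntegral.integral_finsetSum fun j _ =>
    Continuous.intervalIntegrable (by fun_prop) _ _]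
  simp_rw [intervalIntegral.integral_smul_const, integral_fourierMode, sub_eq_zero]
  simp [hk]

/-- A continuous closed loop is determined by its Fourier coefficients. -/
lemma eq_zero_of_loopCoeff_eq_zero [CompleteSpace E] {v : ℝ → E} (hv : Continuous v)
    (h01 : v 0 = v 1) (h : ∀ k, loopCoeff v k = 0) {t : ℝ} (ht : t ∈ Set.Ico (0 : ℝ) 1) :
    v t = 0 := by
  refine ext_inner_left ℂ fun e => ?_
  rw [inner_zero_right]
  have : Fact ((0 : ℝ) < 1) := ⟨one_pos⟩
  let u : ℝ → ℂ := fun s => inner ℂ e (v s)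
  have hu : Continuous u := by fun_prop
  let U : C(AddCircle (1 : ℝ), ℂ) := ⟨AddCircle.liftIco 1 0 u,
    AddCircle.liftIco_continuous (by simp [u, h01]) hu.continuousOn⟩
  have hU : fourierCoeff U = 0 := by
    ext k
    change fourierCoeff (AddCircle.liftIco 1 0 u) k = 0
    rw [fourierCoeff_liftIco_eq, fourierCoeffOn_eq_integral]
    have h1 : ∫ s in (0 : ℝ)..1, fourierMode (-k) s • u s = 0 := by
      have h2 := (innerSL ℂ e).intervalIntegral_comp_comm
        (((continuous_fourierMode (-k)).smul hv).intervalIntegrable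
          (μ := MeasureTheory.volume) 0 1)
      have h3 : ∫ s in (0 : ℝ)..1, fourierMode (-k) s • v s = 0 := h k
      refine Eq.trans ?_ (h2.trans ((congrArg (innerSL ℂ e) h3).trans (map_zero _)))
      refine intervalIntegral.integral_congr fun s _ => ?_
      simp [u]
    have h4 : ∫ s in (0 : ℝ)..(0 + 1), fourier (-k) (s : AddCircle ((0 : ℝ) + 1 - 0)) • u s = 0 := by
      rw [zero_add]
      refine Eq.trans (intervalIntegral.integral_congr fun s _ => ?_) h1
      simp only [fourier_coe_apply, fourierMode]
      simp
    rw [h4, smul_zero]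
  have hs := has_pointwise_sum_fourier_series_of_summable (f := U) (by rw [hU]; exact summable_zero)
    (t : AddCircle (1 : ℝ))
  rw [hU] at hs
  simp only [Pi.zero_apply, zero_smul] at hs
  have h5 := hs.unique hasSum_zero
  have h6 : U (t : AddCircle (1 : ℝ)) = u t :=
    AddCircle.liftIco_coe_apply (a := (0 : ℝ)) (p := 1) (f := u) (x := t) (by rwa [zero_add])
  exact h6.symm.trans h5

/-- A periodic loop whose derivative is `i w` in the weak sense has this derivative classically. -/
lemma hasDerivAt_of_loopCoeff_eq [CompleteSpace E] {x w : ℝ → E} (hx : Continuous x)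
    (hw : Continuous w) (hxp : ∀ t, x (t + 1) = x t) (hwp : ∀ t, w (t + 1) = w t)
    (h : ∀ k : ℤ, ((2 * π * k : ℝ) : ℂ) • loopCoeff x k = loopCoeff w k) (t : ℝ) :
    HasDerivAt x (Complex.I • w t) t := by
  let y : ℝ → E := fun t => ∫ s in (0 : ℝ)..t, Complex.I • w s
  have hy : ∀ t, HasDerivAt y (Complex.I • w t) t := fun t =>
    intervalIntegral.integral_hasDerivAt_right
      (Continuous.intervalIntegrable (by fun_prop) _ _)
      (Continuous.stronglyMeasurableAtFilter (by fun_prop) _ _)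
      (by fun_prop)
  have hyc : Continuous y := continuous_iff_continuousAt.2 fun t => (hy t).continuousAt
  have hy1 : ∫ s in (0 : ℝ)..1, Complex.I • w s = 0 := by
    have h0 := h 0
    rw [intervalIntegral.integral_smul]
    simp only [loopCoeff, neg_zero, fourierMode_zero, one_smul, Int.cast_zero, mul_zero,
      Complex.ofReal_zero, zero_smul] at h0
    rw [← h0, smul_zero]
  have hyper : ∀ t, y (t + 1) = y t := fun t => by
    have h1 : y (t + 1) = y t + ∫ s in t..(t + 1), Complex.I • w s :=
      (intervalIntegral.integral_add_adjacent_intervals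
        (Continuous.intervalIntegrable (by fun_prop) _ _)
        (Continuous.intervalIntegrable (by fun_prop) _ _)).symm
    have hper : Function.Periodic (fun s => Complex.I • w s) 1 := fun s => by simp [hwp]
    have h2 := hper.intervalIntegral_add_eq t 0
    rw [zero_add, hy1] at h2
    rw [h1, h2, add_zero]
  have hcoeff : ∀ k : ℤ, ((2 * π * k : ℝ) : ℂ) • loopCoeff y k = loopCoeff w k := fun k => by
    have hd : ∀ t ∈ Set.uIcc (0 : ℝ) 1, HasDerivAt (fun t => fourierMode (-k) t • y t)
        (fourierMode (-k) t • (Complex.I • w t) +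
          (2 * π * (-k : ℤ) * Complex.I * fourierMode (-k) t) • y t) t := fun t _ =>
      (hasDerivAt_fourierMode (-k) t).smul (hy t)
    have h1 := intervalIntegral.integral_eq_sub_of_hasDerivAt hd
      (Continuous.intervalIntegrable (by fun_prop) _ _)
    have h2 := hyper 0
    have h3 := fourierMode_add_one (-k) 0
    rw [zero_add] at h2 h3
    rw [h2, h3, sub_self, intervalIntegral.integral_add
      (Continuous.intervalIntegrable (by fun_prop) _ _)
      (Continuous.intervalIntegrable (by fun_prop) _ _)] at h1
    have h4 : ∫ t in (0 : ℝ)..1, fourierMode (-k) t • (Complex.I • w t) =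
        Complex.I • loopCoeff w k := by
      rw [loopCoeff, ← intervalIntegral.integral_smul]
      simp_rw [smul_comm Complex.I]
    have h5 : ∫ t in (0 : ℝ)..1, (2 * π * (-k : ℤ) * Complex.I * fourierMode (-k) t) • y t =
        -(Complex.I • (((2 * π * k : ℝ) : ℂ) • loopCoeff y k)) := by
      rw [loopCoeff, ← intervalIntegral.integral_smul, ← intervalIntegral.integral_smul,
        ← intervalIntegral.integral_neg]
      refine intervalIntegral.integral_congr fun t _ => ?_
      simp only [smul_smul, ← neg_smul]
      congr 1
      push_cast; ring
    rw [h4, h5, ← sub_eq_add_neg, ← smul_sub, smul_eq_zero] at h1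
    exact (sub_eq_zero.1 (h1.resolve_left Complex.I_ne_zero)).symm
  set m := loopCoeff (fun t => x t - y t) 0 with hm
  have hsub : ∀ k, loopCoeff (fun t => x t - y t) k = loopCoeff x k - loopCoeff y k := fun k => by
    simp only [loopCoeff, smul_sub]
    exact intervalIntegral.integral_sub
      (Continuous.intervalIntegrable (by fun_prop) _ _)
      (Continuous.intervalIntegrable (by fun_prop) _ _)
  have hzero : ∀ k, loopCoeff (fun t => x t - y t - m) k = 0 := fun k => by
    have h1 : loopCoeff (fun t => x t - y t - m) k =
        loopCoeff (fun t => x t - y t) k - (∫ t in (0 : ℝ)..1, fourierMode (-k) t) • m := by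
      rw [← intervalIntegral.integral_smul_const]
      simp only [loopCoeff, smul_sub]
      exact intervalIntegral.integral_sub
        (Continuous.intervalIntegrable (by fun_prop) _ _)
        (Continuous.intervalIntegrable (by fun_prop) _ _)
    rw [h1, integral_fourierMode]
    rcases eq_or_ne k 0 with rfl | hk
    · simp [hm]
    · have h2 : ((2 * π * k : ℝ) : ℂ) ≠ 0 := by
        rw [Complex.ofReal_ne_zero]
        have : (k : ℝ) ≠ 0 := by exact_mod_cast hk
        positivity
      have h3 : loopCoeff x k = loopCoeff y k :=
        smul_right_injective E h2 ((h k).trans (hcoeff k).symm)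
      rw [hsub, h3]
      simp [hk]
  have hxy : ∀ t, x t = y t + m := fun t => by
    have hp : Function.Periodic (fun t => x t - y t - m) 1 := fun t => by simp [hxp, hyper]
    have h1 := hp.sub_int_mul_eq (x := t) ⌊t⌋
    rw [mul_one] at h1
    have h2 := eq_zero_of_loopCoeff_eq_zero (v := fun t => x t - y t - m) (by fun_prop)
      (by simpa using (hp 0).symm) hzero (t := Int.fract t)
      ⟨Int.fract_nonneg t, Int.fract_lt_one t⟩
    have h3 : x t - y t - m = 0 := h1.symm.trans h2
    rw [sub_sub, sub_eq_zero] at h3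
    exact h3
  have hxy' : x = fun t => y t + m := funext hxy
  rw [hxy']
  exact (hy t).add_const m

end LoopLimits

section PeriodicOrbit

open Filter Topology

variable {E : Type*} [NormedAddCommGroup E] [InnerProductSpace ℂ E]

omit [InnerProductSpace ℂ E] in
lemma norm_add_sq_le_two_mul (x y : E) : ‖x + y‖ ^ 2 ≤ 2 * ‖x‖ ^ 2 + 2 * ‖y‖ ^ 2 := by
  have := norm_add_le x y
  have h2 := pow_le_pow_left₀ (norm_nonneg _) this 2
  nlinarith [sq_nonneg (‖x‖ - ‖y‖)]

/-- A trigonometric polynomial with bounded derivative in `L²` is Hölder continuous. -/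
lemma norm_trigPoly_sub_le {N : ℤ} {a : ℤ → E} {K : ℝ}
    (hK : ∑ k ∈ Finset.Icc (-N) N, ‖((2 * π * k : ℝ) : ℂ) • a k‖ ^ 2 ≤ K) [CompleteSpace E]
    (s t : ℝ) (hst : |t - s| ≤ 1) :
    ‖trigPoly N a t - trigPoly N a s‖ ≤ (K + 1) / 2 * √|t - s| := by
  wlog h : s ≤ t generalizing s t
  · have := this t s (by rwa [abs_sub_comm]) (le_of_not_ge h)
    rwa [norm_sub_rev, abs_sub_comm]
  rw [abs_of_nonneg (sub_nonneg.2 h)] at hst ⊢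
  rcases h.eq_or_lt with rfl | hlt
  · simp
  set d := √(t - s) with hd
  have hd0 : 0 < d := Real.sqrt_pos.2 (sub_pos.2 hlt)
  have hd2 : d * d = t - s := Real.mul_self_sqrt (sub_pos.2 hlt).le
  set b : ℤ → E := fun k => ((2 * π * k : ℝ) : ℂ) • a k with hb
  have h1 : ∫ τ in s..t, Complex.I • trigPoly N b τ = trigPoly N a t - trigPoly N a s :=
    intervalIntegral.integral_eq_sub_of_hasDerivAt (fun τ _ => hasDerivAt_trigPoly N a τ)
      (Continuous.intervalIntegrable (by fun_prop) _ _)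
  rw [← h1]
  have h2 : ∫ τ in s..t, ‖trigPoly N b τ‖ ^ 2 ≤ K := by
    calc ∫ τ in s..t, ‖trigPoly N b τ‖ ^ 2 ≤ ∫ τ in s..(s + 1), ‖trigPoly N b τ‖ ^ 2 := by
          refine intervalIntegral.integral_mono_interval le_rfl h (by linarith) ?_
            (Continuous.intervalIntegrable (by fun_prop) _ _)
          exact Eventually.of_forall fun τ => sq_nonneg _
      _ = ∫ τ in (0 : ℝ)..1, ‖trigPoly N b τ‖ ^ 2 := by
          have hp : Function.Periodic (fun τ => ‖trigPoly N b τ‖ ^ 2) 1 := fun τ => by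
            simp only [trigPoly_add_one]
          have := hp.intervalIntegral_add_eq s 0
          rwa [zero_add] at this
      _ ≤ K := by rw [integral_norm_sq_trigPoly]; exact hK
  calc ‖∫ τ in s..t, Complex.I • trigPoly N b τ‖
      ≤ ∫ τ in s..t, ‖Complex.I • trigPoly N b τ‖ :=
        intervalIntegral.norm_integral_le_integral_norm h
    _ ≤ ∫ τ in s..t, (d / 2 * ‖trigPoly N b τ‖ ^ 2 + 1 / (2 * d)) := by
        refine intervalIntegral.integral_mono_on h
          (Continuous.intervalIntegrable (by fun_prop) _ _)
          (Continuous.intervalIntegrable (by fun_prop) _ _) fun τ _ => ?_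
        rw [norm_smul, Complex.norm_I, one_mul]
        have h3 : 0 ≤ (d * ‖trigPoly N b τ‖ - 1) ^ 2 / (2 * d) := by positivity
        have h4 : (d * ‖trigPoly N b τ‖ - 1) ^ 2 / (2 * d) =
          d / 2 * ‖trigPoly N b τ‖ ^ 2 + 1 / (2 * d) - ‖trigPoly N b τ‖ := by
          field_simp; ring
        linarith
    _ = d / 2 * (∫ τ in s..t, ‖trigPoly N b τ‖ ^ 2) + (t - s) / (2 * d) := by
        rw [intervalIntegral.integral_add (Continuous.intervalIntegrable (by fun_prop) _ _)
          (Continuous.intervalIntegrable (by fun_prop) _ _), intervalIntegral.integral_const_mul,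
          intervalIntegral.integral_const, smul_eq_mul, mul_one_div]
    _ ≤ d / 2 * K + d / 2 := by
        have h5 : (t - s) / (2 * d) = d / 2 := by
          rw [← hd2]; field_simp
        rw [h5]
        gcongr
    _ = (K + 1) / 2 * d := by ring

lemma norm_sq_trigPoly_le {N : ℤ} {a : ℤ → E} {K₀ M : ℝ}
    (hK : ∑ k ∈ Finset.Icc (-N) N, ‖a k‖ ^ 2 ≤ K₀)
    (hM : ∀ s t, |t - s| ≤ 1 → ‖trigPoly N a t - trigPoly N a s‖ ≤ M * √|t - s|) (hM0 : 0 ≤ M)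
    (t : ℝ) : ‖trigPoly N a t‖ ^ 2 ≤ 2 * M ^ 2 + 2 * K₀ := by
  have hp : Function.Periodic (fun t => trigPoly N a t) 1 := trigPoly_add_one N a
  have h0 : trigPoly N a t = trigPoly N a (Int.fract t) := by
    have := hp.sub_int_mul_eq (x := t) ⌊t⌋
    rw [mul_one] at this
    exact this.symm
  rw [h0]
  have h1 : ∫ _ in (0 : ℝ)..1, ‖trigPoly N a (Int.fract t)‖ ^ 2 ≤
      ∫ s in (0 : ℝ)..1, (2 * M ^ 2 + 2 * ‖trigPoly N a s‖ ^ 2) := by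
    refine intervalIntegral.integral_mono_on zero_le_one
      (Continuous.intervalIntegrable (by fun_prop) _ _)
      (Continuous.intervalIntegrable (by fun_prop) _ _) fun s hs => ?_
    have hst : |Int.fract t - s| ≤ 1 := by
      rw [abs_le]
      constructor <;> linarith [Int.fract_nonneg t, Int.fract_lt_one t, hs.1, hs.2]
    have h2 := norm_add_sq_le_two_mul (trigPoly N a (Int.fract t) - trigPoly N a s)
      (trigPoly N a s)
    rw [sub_add_cancel] at h2
    have h3 : ‖trigPoly N a (Int.fract t) - trigPoly N a s‖ ≤ M :=
      (hM s _ hst).trans (mul_le_of_le_one_right hM0 (Real.sqrt_le_one.2 hst))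
    have h4 := pow_le_pow_left₀ (norm_nonneg _) h3 2
    linarith
  rw [intervalIntegral.integral_add (Continuous.intervalIntegrable (by fun_prop) _ _)
    (Continuous.intervalIntegrable (by fun_prop) _ _), intervalIntegral.integral_const_mul 2,
    intervalIntegral.integral_const_mul 2, integral_norm_sq_trigPoly] at h1
  simp only [intervalIntegral.integral_const, sub_zero, one_smul] at h1
  linarith

namespace TameHamiltonian

variable {H : E → ℝ} {g : E → E} {Q : E →L[ℂ] E} {C : ℝ}

/-- Almost critical points are bounded in `H¹` when the linear part is nonresonant. -/
lemma sum_sq_le [CompleteSpace E] (hH : TameHamiltonian H g Q C) {c : ℝ} (hc : 0 < c)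
    (hgap : ∀ (k : ℤ) (v : E), c * ‖v‖ ≤ ‖((2 * π * k : ℝ) : ℂ) • v - Q v‖) {N : ℤ} {a : ℤ → E}
    (ha : galerkinGradSq g N a ≤ 1) :
    ∑ k ∈ Finset.Icc (-N) N, ‖a k‖ ^ 2 ≤ (2 + 2 * C ^ 2) / c ^ 2 ∧
    ∑ k ∈ Finset.Icc (-N) N, ‖((2 * π * k : ℝ) : ℂ) • a k‖ ^ 2 ≤
      2 * (2 + 2 * C ^ 2) + 2 * ‖Q‖ ^ 2 * ((2 + 2 * C ^ 2) / c ^ 2) := by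
  have hg := hH.continuous_grad
  set S := Finset.Icc (-N) N
  set u : ℤ → E := fun k => loopCoeff (fun t => g (trigPoly N a t)) k - Q (a k) with hu
  have h1 : ∑ k ∈ S, ‖u k‖ ^ 2 ≤ C ^ 2 := by
    have h2 : ∑ k ∈ S, ‖u k‖ ^ 2 = ∫ t in (0 : ℝ)..1,
        rinner (g (trigPoly N a t) - Q (trigPoly N a t)) (trigPoly N u t) := by
      simp_rw [rinner_sub_left]
      rw [intervalIntegral.integral_sub (Continuous.intervalIntegrable (by fun_prop) _ _)
        (Continuous.intervalIntegrable (by fun_prop) _ _), ← sum_rinner_loopCoeff (by fun_prop)]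
      simp_rw [map_trigPoly]
      rw [integral_rinner_trigPoly, ← Finset.sum_sub_distrib]
      refine Finset.sum_congr rfl fun k _ => ?_
      rw [← rinner_sub_left, ← rinner_self]
    have h3 : ∫ t in (0 : ℝ)..1,
        rinner (g (trigPoly N a t) - Q (trigPoly N a t)) (trigPoly N u t) ≤
        ∫ t in (0 : ℝ)..1, (C ^ 2 / 2 + 1 / 2 * ‖trigPoly N u t‖ ^ 2) := by
      refine intervalIntegral.integral_mono_on zero_le_one
        (Continuous.intervalIntegrable (by fun_prop) _ _)
        (Continuous.intervalIntegrable (by fun_prop) _ _) fun t _ => ?_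
      have h4 := (le_abs_self _).trans
        (abs_rinner_le (g (trigPoly N a t) - Q (trigPoly N a t)) (trigPoly N u t))
      have h5 := mul_le_mul_of_nonneg_right (hH.norm_grad_sub_le (trigPoly N a t))
        (norm_nonneg (trigPoly N u t))
      nlinarith [sq_nonneg (C - ‖trigPoly N u t‖)]
    rw [intervalIntegral.integral_add (Continuous.intervalIntegrable (by fun_prop) _ _)
      (Continuous.intervalIntegrable (by fun_prop) _ _), intervalIntegral.integral_const_mul,
      integral_norm_sq_trigPoly, ← h2] at h3
    simp only [intervalIntegral.integral_const, sub_zero, one_smul] at h3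
    linarith
  have hdec : ∀ k ∈ S, ((2 * π * k : ℝ) : ℂ) • a k - Q (a k) = galerkinGrad g N a k + u k := by
    intro k hk
    rw [galerkinGrad, if_pos hk]
    simp only [hu]
    abel
  have hsum : ∑ k ∈ S, ‖((2 * π * k : ℝ) : ℂ) • a k - Q (a k)‖ ^ 2 ≤ 2 + 2 * C ^ 2 := by
    calc _ ≤ ∑ k ∈ S, (2 * ‖galerkinGrad g N a k‖ ^ 2 + 2 * ‖u k‖ ^ 2) := by
          refine Finset.sum_le_sum fun k hk => ?_
          rw [hdec k hk]
          exact norm_add_sq_le_two_mul _ _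
      _ = 2 * galerkinGradSq g N a + 2 * ∑ k ∈ S, ‖u k‖ ^ 2 := by
          rw [Finset.sum_add_distrib, ← Finset.mul_sum, ← Finset.mul_sum, galerkinGradSq]
      _ ≤ _ := by linarith
  have hfirst : ∑ k ∈ S, ‖a k‖ ^ 2 ≤ (2 + 2 * C ^ 2) / c ^ 2 := by
    rw [le_div_iff₀ (by positivity), Finset.sum_mul]
    refine (Finset.sum_le_sum fun k _ => ?_).trans hsum
    have := pow_le_pow_left₀ (by positivity) (hgap k (a k)) 2
    linarith [mul_pow c ‖a k‖ 2]
  refine ⟨hfirst, ?_⟩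
  calc ∑ k ∈ S, ‖((2 * π * k : ℝ) : ℂ) • a k‖ ^ 2
      ≤ ∑ k ∈ S, (2 * ‖((2 * π * k : ℝ) : ℂ) • a k - Q (a k)‖ ^ 2 +
          2 * ‖Q‖ ^ 2 * ‖a k‖ ^ 2) := by
        refine Finset.sum_le_sum fun k _ => ?_
        have h5 := norm_add_sq_le_two_mul (((2 * π * k : ℝ) : ℂ) • a k - Q (a k)) (Q (a k))
        rw [sub_add_cancel] at h5
        have h6 := pow_le_pow_left₀ (norm_nonneg _) (Q.le_opNorm (a k)) 2
        rw [mul_pow] at h6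
        linarith
    _ = 2 * ∑ k ∈ S, ‖((2 * π * k : ℝ) : ℂ) • a k - Q (a k)‖ ^ 2 +
          2 * ‖Q‖ ^ 2 * ∑ k ∈ S, ‖a k‖ ^ 2 := by
        rw [Finset.sum_add_distrib, ← Finset.mul_sum, ← Finset.mul_sum]
    _ ≤ _ := by gcongr

lemma galerkinAction_eq [CompleteSpace E] (hH : TameHamiltonian H g Q C) (N : ℤ) (a : ℤ → E) :
    galerkinAction H N a = 1 / 2 * ∑ k ∈ Finset.Icc (-N) N, rinner (galerkinGrad g N a k) (a k) +
      ∫ t in (0 : ℝ)..1, (1 / 2 * rinner (g (trigPoly N a t)) (trigPoly N a t)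
        - H (trigPoly N a t)) := by
  have hg := hH.continuous_grad
  have hc := hH.continuous_ham
  rw [intervalIntegral.integral_sub (Continuous.intervalIntegrable (by fun_prop) _ _)
    (Continuous.intervalIntegrable (by fun_prop) _ _), intervalIntegral.integral_const_mul,
    ← sum_rinner_loopCoeff (by fun_prop), galerkinAction, add_sub, ← mul_add,
    ← Finset.sum_add_distrib, Finset.mul_sum, Finset.mul_sum]
  congr 1
  refine Finset.sum_congr rfl fun k hk => ?_
  rw [← rinner_add_left, galerkinGrad, if_pos hk, sub_add_cancel, rinner_smul_left, rinner_self]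
  ring

/-- Existence of a `1`-periodic orbit with positive action. -/
theorem exists_periodic_orbit [FiniteDimensional ℂ E] (hH : TameHamiltonian H g Q C)
    {e : E} (he : ‖e‖ = 1) {κ₁ κ₂ : ℝ} (he' : 1 / 2 * rinner (Q e) e = κ₁) (hκ₁ : π < κ₁)
    (hκ₂ : 0 < κ₂) (hκ : ∀ v, κ₂ * ‖v‖ ^ 2 ≤ 1 / 2 * rinner (Q v) v) {p : E} {C₄ : ℝ}
    (hp : ∀ v, H (p + v) ≤ C₄ * ‖v‖ ^ 4) (hC₄ : 0 ≤ C₄) {c : ℝ} (hc : 0 < c)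
    (hgap : ∀ (k : ℤ) (v : E), c * ‖v‖ ≤ ‖((2 * π * k : ℝ) : ℂ) • v - Q v‖) :
    ∃ x : ℝ → E, (∀ t, HasDerivAt x (Complex.I • g (x t)) t) ∧ (∀ t, x (t + 1) = x t) ∧
      0 < ∫ t in (0 : ℝ)..1, (1 / 2 * rinner (g (x t)) (x t) - H (x t)) := by
  have : CompleteSpace E := FiniteDimensional.complete ℂ E
  have hg := hH.continuous_grad
  have hHc := hH.continuous_ham
  obtain ⟨α, hα, hcrit⟩ := hH.exists_galerkinGradSq_lt he he' hκ₁ hκ₂ hκ hp hC₄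
  have hN : ∀ n : ℕ, (1 : ℤ) ≤ (n + 1 : ℤ) := fun n => by omega
  have hpos : ∀ n : ℕ, (0 : ℝ) < 1 / ((n : ℝ) + 1) ^ 2 := fun n => by positivity
  choose a ha using fun n : ℕ => hcrit (n + 1) (hN n) (1 / ((n : ℝ) + 1) ^ 2) (hpos n)
  have hle1 : ∀ n : ℕ, galerkinGradSq g (n + 1) (a n) ≤ 1 := fun n => by
    refine (ha n).2.le.trans ?_
    rw [div_le_one (by positivity)]
    have : (0 : ℝ) ≤ n := Nat.cast_nonneg n
    nlinarith
  set K₀ := (2 + 2 * C ^ 2) / c ^ 2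
  set K := 2 * (2 + 2 * C ^ 2) + 2 * ‖Q‖ ^ 2 * K₀
  have hb := fun n : ℕ => hH.sum_sq_le hc hgap (hle1 n)
  set M := (K + 1) / 2
  have hM0 : 0 ≤ M := by positivity
  let f : ℕ → ℝ → E := fun n => trigPoly (n + 1) (a n)
  have hfc : ∀ n, Continuous (f n) := fun n => continuous_trigPoly _ _
  have hM : ∀ n s t, |t - s| ≤ 1 → ‖f n t - f n s‖ ≤ M * √|t - s| :=
    fun n => norm_trigPoly_sub_le (hb n).2
  have hB : ∀ n t, ‖f n t‖ ≤ √(2 * M ^ 2 + 2 * K₀) := fun n t =>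
    Real.le_sqrt_of_sq_le (norm_sq_trigPoly_le (hb n).1 (hM n) hM0 t)
  obtain ⟨φ, x, hφ, hx, hxper, hlim⟩ :=
    exists_subseq_tendsto_of_periodic (fun n t => trigPoly_add_one _ _ t) hB hM
  have hsq : Tendsto (fun n : ℕ => 1 / ((n : ℝ) + 1)) atTop (𝓝 0) :=
    tendsto_one_div_add_atTop_nhds_zero_nat
  have hweak : ∀ k : ℤ, ((2 * π * k : ℝ) : ℂ) • loopCoeff x k =
      loopCoeff (fun t => g (x t)) k := by
    intro k
    have h1 : Tendsto (fun n => loopCoeff (f (φ n)) k) atTop (𝓝 (loopCoeff x k)) :=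
      tendsto_integral_comp_of_bounded (ψ := fun t z => fourierMode (-k) t • z) (by fun_prop)
        (fun n => hfc _) (fun n => hB _) hlim
    have h2 : Tendsto (fun n => loopCoeff (fun t => g (f (φ n) t)) k) atTop
        (𝓝 (loopCoeff (fun t => g (x t)) k)) :=
      tendsto_integral_comp_of_bounded (ψ := fun t z => fourierMode (-k) t • g z) (by fun_prop)
        (fun n => hfc _) (fun n => hB _) hlim
    have h3 := (h1.const_smul ((2 * π * k : ℝ) : ℂ)).sub h2
    have h4 : Tendsto (fun n => ((2 * π * k : ℝ) : ℂ) • loopCoeff (f (φ n)) k -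
        loopCoeff (fun t => g (f (φ n) t)) k) atTop (𝓝 0) := by
      refine squeeze_zero_norm' ?_ (hsq.comp hφ.tendsto_atTop)
      filter_upwards [eventually_ge_atTop k.natAbs] with n hn
      have hk : k ∈ Finset.Icc (-((φ n : ℤ) + 1)) ((φ n : ℤ) + 1) := by
        have := hφ.id_le n
        simp only [id] at this
        rw [Finset.mem_Icc]; omega
      have h5 : ((2 * π * k : ℝ) : ℂ) • loopCoeff (f (φ n)) k -
          loopCoeff (fun t => g (f (φ n) t)) k = galerkinGrad g (φ n + 1) (a (φ n)) k := by
        rw [galerkinGrad, if_pos hk, loopCoeff_trigPoly hk]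
      rw [h5]
      have h6 : ‖galerkinGrad g (φ n + 1) (a (φ n)) k‖ ^ 2 ≤ (1 / ((φ n : ℝ) + 1)) ^ 2 := by
        rw [div_pow, one_pow]
        refine le_trans ?_ (ha (φ n)).2.le
        exact Finset.single_le_sum (f := fun k => ‖galerkinGrad g (φ n + 1) (a (φ n)) k‖ ^ 2)
          (fun _ _ => sq_nonneg _) hk
      have h7 : (0 : ℝ) ≤ 1 / ((φ n : ℝ) + 1) := by positivity
      exact (sq_le_sq₀ (norm_nonneg _) h7).1 h6
    exact sub_eq_zero.1 (tendsto_nhds_unique h3 h4)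
  refine ⟨x, fun t => hasDerivAt_of_loopCoeff_eq hx (by fun_prop) hxper
    (fun t => by rw [hxper]) hweak t, hxper, ?_⟩
  refine lt_of_lt_of_le hα ?_
  have h1 : Tendsto (fun n => ∫ t in (0 : ℝ)..1,
      (1 / 2 * rinner (g (f (φ n) t)) (f (φ n) t) - H (f (φ n) t))) atTop
      (𝓝 (∫ t in (0 : ℝ)..1, (1 / 2 * rinner (g (x t)) (x t) - H (x t)))) :=
    tendsto_integral_comp_of_bounded (ψ := fun _ z => 1 / 2 * rinner (g z) z - H z)
      (by fun_prop) (fun n => hfc _) (fun n => hB _) hlim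
  have h2 : Tendsto (fun n => (1 + K₀) * (1 / ((φ n : ℝ) + 1))) atTop (𝓝 0) := by
    have := (hsq.comp hφ.tendsto_atTop).const_mul (1 + K₀)
    rwa [mul_zero] at this
  have h3 := h2.add h1
  rw [zero_add] at h3
  refine ge_of_tendsto h3 (Eventually.of_forall fun n => ?_)
  refine (ha (φ n)).1.trans ?_
  rw [hH.galerkinAction_eq]
  refine add_le_add ?_ le_rfl
  set s : ℝ := (φ n : ℝ) + 1 with hs
  have hs0 : 0 < s := by positivity
  have h4 : ∑ k ∈ Finset.Icc (-((φ n : ℤ) + 1)) ((φ n : ℤ) + 1),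
      rinner (galerkinGrad g (φ n + 1) (a (φ n)) k) (a (φ n) k) ≤
      s * galerkinGradSq g (φ n + 1) (a (φ n)) + 1 / s *
        ∑ k ∈ Finset.Icc (-((φ n : ℤ) + 1)) ((φ n : ℤ) + 1), ‖a (φ n) k‖ ^ 2 := by
    rw [galerkinGradSq, Finset.mul_sum, Finset.mul_sum, ← Finset.sum_add_distrib]
    refine Finset.sum_le_sum fun k _ => ?_
    refine ((le_abs_self _).trans (abs_rinner_le _ _)).trans ?_
    set A := ‖galerkinGrad g (φ n + 1) (a (φ n)) k‖
    set B := ‖a (φ n) k‖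
    have h5 : 0 ≤ (s * A - B) ^ 2 / s + A * B :=
      add_nonneg (div_nonneg (sq_nonneg _) hs0.le) (mul_nonneg (norm_nonneg _) (norm_nonneg _))
    have h6 : s * A ^ 2 + 1 / s * B ^ 2 - A * B = (s * A - B) ^ 2 / s + A * B := by
      field_simp; ring
    linarith
  have h7 : s * galerkinGradSq g (φ n + 1) (a (φ n)) ≤ 1 / s := by
    have := mul_le_mul_of_nonneg_left (ha (φ n)).2.le hs0.le
    refine this.trans (le_of_eq ?_)
    rw [← hs]; field_simp
  have h8 : 1 / s * ∑ k ∈ Finset.Icc (-((φ n : ℤ) + 1)) ((φ n : ℤ) + 1), ‖a (φ n) k‖ ^ 2 ≤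
      1 / s * K₀ := by
    have := (hb (φ n)).1
    gcongr
  have h9 : 0 ≤ (1 + K₀) * (1 / s) := by positivity
  nlinarith

end TameHamiltonian

end PeriodicOrbit

section Profile

/-- A smooth nonincreasing profile, constant near `0`, vanishing near `r ^ 2`, with slope bounded by
`π` and height larger than `π * R ^ 2`. -/
lemma exists_profile {r R : ℝ} (hR : 0 < R) (h : R < r) :
    ∃ (F F' : ℝ → ℝ) (m s₀ s₁ : ℝ), ContDiff ℝ ∞ F ∧ (∀ s, HasDerivAt F (F' s) s) ∧
      (∀ s, -π < F' s ∧ F' s ≤ 0) ∧ π * R ^ 2 < m ∧ 0 < s₀ ∧ (∀ s ≤ s₀, F s = m) ∧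
      0 < s₁ ∧ s₁ < r ^ 2 ∧ (∀ s, s₁ ≤ s → F s = 0) ∧ ∀ s, 0 ≤ F s ∧ F s ≤ m := by
  have hRr : R ^ 2 < r ^ 2 := by nlinarith
  have hR2 : 0 < R ^ 2 := by positivity
  obtain ⟨ρ, hρ1, hρ2⟩ := exists_between (show R ^ 2 / 2 < r ^ 2 / 2 by linarith)
  obtain ⟨ρ', hρ'1, hρ'2⟩ := exists_between hρ2
  have hρ0 : 0 < ρ := by linarith
  let b : ContDiffBump (r ^ 2 / 2 : ℝ) := ⟨ρ, ρ', hρ0, hρ'1⟩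
  obtain ⟨c, hc1, hc2⟩ := exists_between (show π * R ^ 2 / (2 * ρ) < π by
    rw [div_lt_iff₀ (by positivity)]; nlinarith [pi_pos])
  have hc0 : 0 < c := lt_of_le_of_lt (by positivity) hc1
  have hbc : Continuous b := b.continuous
  let s₁ := r ^ 2 / 2 + ρ'
  let s₀ := r ^ 2 / 2 - ρ'
  let F : ℝ → ℝ := fun s => -∫ t in s₁..s, c * b t
  have hF : ∀ s, HasDerivAt F (-(c * b s)) s := fun s =>
    (((hbc.const_mul c).integral_hasStrictDerivAt s₁ s).hasDerivAt).fun_neg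
  have hint : ∀ x y, IntervalIntegrable (fun t => c * b t) MeasureTheory.volume x y :=
    fun x y => (hbc.const_mul c).intervalIntegrable _ _
  have hanti : Antitone F := antitone_of_hasDerivAt_nonpos hF fun s =>
    neg_nonpos.2 (mul_nonneg hc0.le b.nonneg)
  have hdiff : ∀ x y, F x - F y = ∫ t in x..y, c * b t := fun x y => by
    have := intervalIntegral.integral_interval_sub_left (hint s₁ y) (hint s₁ x)
    simp only [F]; linarith
  have hbz : ∀ t, ρ' ≤ |t - r ^ 2 / 2| → b t = 0 := fun t ht =>
    b.zero_of_le_dist (by rw [Real.dist_eq]; exact ht)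
  have hlow : ∀ s ≤ s₀, F s = F s₀ := fun s hs => by
    have : F s - F s₀ = 0 := by
      rw [hdiff, intervalIntegral.integral_congr (g := fun _ => 0), intervalIntegral.integral_zero]
      intro t ht
      rw [Set.uIcc_of_le hs] at ht
      simp only [s₀] at ht
      simp [hbz t (by rw [abs_of_nonpos] <;> linarith [ht.2])]
    linarith
  have hhigh : ∀ s, s₁ ≤ s → F s = 0 := fun s hs => by
    have h0 : F s₁ = 0 := by simp [F]
    have : F s₁ - F s = 0 := by
      rw [hdiff, intervalIntegral.integral_congr (g := fun _ => 0), intervalIntegral.integral_zero]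
      intro t ht
      rw [Set.uIcc_of_le hs] at ht
      simp only [s₁] at ht
      simp [hbz t (by rw [abs_of_nonneg] <;> linarith [ht.1])]
    linarith
  have hle : ∀ s, F s ≤ F s₀ := fun s => by
    rcases le_total s s₀ with hs | hs
    · exact (hlow s hs).le
    · exact hanti hs
  have hge : ∀ s, 0 ≤ F s := fun s => by
    rcases le_total s₁ s with hs | hs
    · exact (hhigh s hs).ge
    · exact (hhigh s₁ le_rfl).symm.le.trans (hanti hs)
  have hm : π * R ^ 2 < F s₀ := by
    have h1 : F (r ^ 2 / 2 - ρ) - F (r ^ 2 / 2 + ρ) = 2 * ρ * c := by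
      rw [hdiff, intervalIntegral.integral_congr (g := fun _ => c), intervalIntegral.integral_const,
        smul_eq_mul]
      · ring
      · intro t ht
        rw [Set.uIcc_of_le (by linarith)] at ht
        have : b t = 1 := b.one_of_mem_closedBall (by
          rw [Metric.mem_closedBall, Real.dist_eq, abs_le]
          constructor <;> simp only [b] <;> linarith [ht.1, ht.2])
        simp [this]
    have h2 := hle (r ^ 2 / 2 - ρ)
    have h3 := hge (r ^ 2 / 2 + ρ)
    rw [div_lt_iff₀ (by positivity)] at hc1
    linarith
  refine ⟨F, fun s => -(c * b s), F s₀, s₀, s₁, ?_, hF, fun s => ⟨?_, ?_⟩, hm,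
    by simp only [s₀]; linarith, hlow, by simp only [s₁]; linarith [sq_nonneg r],
    by simp only [s₁]; linarith, hhigh, fun s => ⟨hge s, hle s⟩⟩
  · have : deriv F = fun s => -(c * b s) := funext fun s => (hF s).deriv
    rw [contDiff_infty_iff_deriv, this]
    exact ⟨fun s => (hF s).differentiableAt, (contDiff_const.mul b.contDiff).neg⟩
  · have := b.le_one (x := s); have := b.nonneg (x := s); nlinarith
  · have := b.nonneg (x := s); simp only [Left.neg_nonpos_iff]; positivity

/-- The slope of the convex function `huber`. -/
def huberSlope (c₀ d s : ℝ) : ℝ := max 0 (min 1 ((s - c₀) / d))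

/-- A convex function of class `C¹`, vanishing for `s ≤ c₀` and of slope one for `c₀ + d ≤ s`. -/
def huber (c₀ d s : ℝ) : ℝ := huberSlope c₀ d s * (s - c₀) - d * huberSlope c₀ d s ^ 2 / 2

lemma huberSlope_nonneg (c₀ d s : ℝ) : 0 ≤ huberSlope c₀ d s := le_max_left _ _

lemma huberSlope_le_one (c₀ d s : ℝ) : huberSlope c₀ d s ≤ 1 := by simp [huberSlope]

lemma continuous_huberSlope (c₀ d : ℝ) : Continuous (huberSlope c₀ d) := by
  unfold huberSlope; fun_prop

lemma continuous_huber (c₀ d : ℝ) : Continuous (huber c₀ d) := by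
  have := continuous_huberSlope c₀ d
  unfold huber; fun_prop

lemma huberSlope_of_le {c₀ d s : ℝ} (hd : 0 < d) (h : s ≤ c₀) : huberSlope c₀ d s = 0 := by
  refine max_eq_left ((min_le_right _ _).trans (div_nonpos_of_nonpos_of_nonneg ?_ hd.le))
  linarith

lemma huber_of_le {c₀ d s : ℝ} (hd : 0 < d) (h : s ≤ c₀) : huber c₀ d s = 0 := by
  simp [huber, huberSlope_of_le hd h]

lemma huberSlope_of_ge {c₀ d s : ℝ} (hd : 0 < d) (h : c₀ + d ≤ s) : huberSlope c₀ d s = 1 := by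
  have : 1 ≤ (s - c₀) / d := by rw [le_div_iff₀ hd]; linarith
  simp [huberSlope, this]

lemma le_huber {c₀ d μ : ℝ} (hd : 0 < d) (hμ : 0 ≤ μ) (hμ' : μ ≤ 1) (s : ℝ) :
    μ * (s - c₀) - d * μ ^ 2 / 2 ≤ huber c₀ d s := by
  rcases le_total s c₀ with h | h
  · rw [huber_of_le hd h]
    nlinarith [mul_nonneg hμ (sub_nonneg.2 h), sq_nonneg μ]
  rcases le_total (c₀ + d) s with h' | h'
  · rw [huber, huberSlope_of_ge hd h']
    nlinarith [mul_nonneg (sub_nonneg.2 hμ') (sub_nonneg.2 h'),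
      mul_nonneg hd.le (sq_nonneg (1 - μ))]
  · have h1 : huberSlope c₀ d s = (s - c₀) / d := by
      have h2 : (s - c₀) / d ≤ 1 := by rw [div_le_one hd]; linarith
      have h3 : 0 ≤ (s - c₀) / d := div_nonneg (by linarith) hd.le
      simp [huberSlope, h2, h3]
    have h4 : s - c₀ = d * ((s - c₀) / d) := by field_simp
    rw [huber, h1]
    set l := (s - c₀) / d
    rw [h4]
    nlinarith [mul_nonneg hd.le (sq_nonneg (l - μ))]

lemma huber_add_le {c₀ d : ℝ} (hd : 0 < d) (s s' : ℝ) :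
    huber c₀ d s + huberSlope c₀ d s * (s' - s) ≤ huber c₀ d s' := by
  have := le_huber (c₀ := c₀) hd (huberSlope_nonneg c₀ d s) (huberSlope_le_one c₀ d s) s'
  rw [huber]
  linarith

lemma huber_nonneg {c₀ d : ℝ} (hd : 0 < d) (s : ℝ) : 0 ≤ huber c₀ d s := by
  have := le_huber (c₀ := c₀) hd le_rfl zero_le_one s
  simpa using this

lemma sub_le_huber {c₀ d : ℝ} (hd : 0 < d) (s : ℝ) : s - c₀ - d / 2 ≤ huber c₀ d s := by
  have := le_huber (c₀ := c₀) hd zero_le_one le_rfl s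
  linarith

lemma huber_le_self {c₀ d s : ℝ} (hd : 0 < d) (hc : 0 ≤ c₀) (hs : 0 ≤ s) : huber c₀ d s ≤ s := by
  have h1 := huberSlope_nonneg c₀ d s
  have h2 := huberSlope_le_one c₀ d s
  rw [huber]
  nlinarith [mul_nonneg h1 hc, mul_nonneg (sub_nonneg.2 h2) hs,
    mul_nonneg hd.le (sq_nonneg (huberSlope c₀ d s))]

lemma huberSlope_mul_sub_huber_le {c₀ d : ℝ} (hd : 0 < d) (hc : 0 ≤ c₀) (s : ℝ) :
    huberSlope c₀ d s * s - huber c₀ d s ≤ c₀ + d / 2 := by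
  have h1 := huberSlope_nonneg c₀ d s
  have h2 := huberSlope_le_one c₀ d s
  rw [huber]
  nlinarith [mul_nonneg (sub_nonneg.2 h2) hc, mul_nonneg hd.le (mul_nonneg (sub_nonneg.2 h2) h1),
    mul_nonneg hd.le (sub_nonneg.2 h2)]

end Profile

section Gradient

variable {E : Type*} [NormedAddCommGroup E] [InnerProductSpace ℂ E]

/-- The gradient vector of a real linear functional with respect to `rinner`. -/
def rgrad [FiniteDimensional ℂ E] (l : E →L[ℝ] ℝ) : E :=
  letI := InnerProductSpace.rclikeToReal ℂ E
  haveI : CompleteSpace E := FiniteDimensional.complete ℂ E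
  (InnerProductSpace.toDual ℝ E).symm l

variable [FiniteDimensional ℂ E]

lemma rinner_rgrad (l : E →L[ℝ] ℝ) (w : E) : rinner (rgrad l) w = l w := by
  let _ := InnerProductSpace.rclikeToReal ℂ E
  have _ : CompleteSpace E := FiniteDimensional.complete ℂ E
  exact InnerProductSpace.toDual_symm_apply (𝕜 := ℝ) (E := E) (x := w) (y := l)

lemma norm_rgrad (l : E →L[ℝ] ℝ) : ‖rgrad l‖ = ‖l‖ := by
  let _ := InnerProductSpace.rclikeToReal ℂ E
  have _ : CompleteSpace E := FiniteDimensional.complete ℂ E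
  exact (InnerProductSpace.toDual ℝ E).symm.norm_map l

lemma rgrad_zero : rgrad (0 : E →L[ℝ] ℝ) = 0 := by
  rw [← norm_eq_zero, norm_rgrad, norm_zero]

lemma continuous_rgrad : Continuous (rgrad : (E →L[ℝ] ℝ) → E) := by
  let _ := InnerProductSpace.rclikeToReal ℂ E
  have _ : CompleteSpace E := FiniteDimensional.complete ℂ E
  exact (InnerProductSpace.toDual ℝ E).symm.continuous

end Gradient

section Taylor

variable {E : Type*} [NormedAddCommGroup E] [NormedSpace ℝ E]

lemma exists_taylor_bound {h : E → ℝ} (h1 : ContDiff ℝ ∞ h) (h2 : HasCompactSupport h) :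
    ∃ C : ℝ, 0 ≤ C ∧ (∀ z, ‖fderiv ℝ h z‖ ≤ C) ∧
      ∀ z w, |h (z + w) - h z - fderiv ℝ h z w| ≤ C * ‖w‖ ^ 2 := by
  have hd : ContDiff ℝ 1 (fderiv ℝ h) := h1.fderiv_right (by norm_cast)
  have hs : HasCompactSupport (fderiv ℝ h) := h2.fderiv (𝕜 := ℝ)
  obtain ⟨C, hC⟩ := hd.lipschitzWith_of_hasCompactSupport hs one_ne_zero
  obtain ⟨B, hB⟩ := hs.exists_bound_of_continuous hd.continuous
  refine ⟨max C B, le_max_of_le_left C.2, fun z => (hB z).trans (le_max_right _ _), fun z w => ?_⟩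
  have := (convex_segment z (z + w)).norm_image_sub_le_of_norm_fderiv_le' (𝕜 := ℝ) (f := h)
    (φ := fderiv ℝ h z) (C := C * ‖w‖) (fun x _ => h1.differentiable (by norm_num) x) (fun x hx => ?_)
    (left_mem_segment ℝ z (z + w)) (right_mem_segment ℝ z (z + w))
  · rw [add_sub_cancel_left, Real.norm_eq_abs] at this
    refine this.trans ?_
    nlinarith [le_max_left (C : ℝ) B, sq_nonneg ‖w‖]
  · rw [← dist_eq_norm]
    refine (hC.dist_le_mul x z).trans (mul_le_mul_of_nonneg_left ?_ C.2)
    rw [dist_eq_norm]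
    simpa using norm_sub_le_of_mem_segment hx

end Taylor

section Ellipsoid

variable {E : Type*} [NormedAddCommGroup E] [InnerProductSpace ℂ E]

/-- The complex linear map equal to `2 * κ₁` along `e` and to `2 * κ₂` orthogonally to `e`. -/
def ellipsoidMap (e : E) (κ₁ κ₂ : ℝ) : E →L[ℂ] E :=
  ((2 * κ₂ : ℝ) : ℂ) • ContinuousLinearMap.id ℂ E +
    ((2 * (κ₁ - κ₂) : ℝ) : ℂ) • (innerSL ℂ e).smulRight e

/-- The quadratic form with gradient `ellipsoidMap`. -/
def ellipsoidForm (e : E) (κ₁ κ₂ : ℝ) (z : E) : ℝ := 1 / 2 * rinner (ellipsoidMap e κ₁ κ₂ z) z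

variable {e : E} {κ₁ κ₂ : ℝ}

lemma rinner_neg_left (x y : E) : rinner (-x) y = -rinner x y := by
  simp [rinner]

lemma ellipsoidMap_apply (z : E) : ellipsoidMap e κ₁ κ₂ z =
    ((2 * κ₂ : ℝ) : ℂ) • z + ((2 * (κ₁ - κ₂) : ℝ) : ℂ) • (inner ℂ e z • e) := by
  simp [ellipsoidMap]

lemma rinner_inner_smul (z w : E) :
    rinner (inner ℂ e z • e) w = (inner ℂ e w * (starRingEnd ℂ) (inner ℂ e z)).re := by
  rw [rinner, inner_smul_left, mul_comm]

lemma rinner_inner_smul_comm (z w : E) :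
    rinner (inner ℂ e z • e) w = rinner (inner ℂ e w • e) z := by
  rw [rinner_inner_smul, rinner_inner_smul]
  simp only [Complex.mul_re, Complex.conj_re, Complex.conj_im]
  ring

lemma rinner_inner_smul_self (z : E) : rinner (inner ℂ e z • e) z = ‖inner ℂ e z‖ ^ 2 := by
  rw [rinner_inner_smul, Complex.mul_conj, Complex.ofReal_re, Complex.normSq_eq_norm_sq]

lemma rinner_ellipsoidMap (z w : E) : rinner (ellipsoidMap e κ₁ κ₂ z) w =
    2 * κ₂ * rinner z w + 2 * (κ₁ - κ₂) * rinner (inner ℂ e z • e) w := by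
  rw [ellipsoidMap_apply, rinner_add_left, rinner_smul_left, rinner_smul_left]

lemma ellipsoidForm_eq (z : E) :
    ellipsoidForm e κ₁ κ₂ z = κ₂ * ‖z‖ ^ 2 + (κ₁ - κ₂) * ‖inner ℂ e z‖ ^ 2 := by
  rw [ellipsoidForm, rinner_ellipsoidMap, rinner_self, rinner_inner_smul_self]
  ring

lemma ellipsoidForm_add (z w : E) : ellipsoidForm e κ₁ κ₂ (z + w) =
    ellipsoidForm e κ₁ κ₂ z + rinner (ellipsoidMap e κ₁ κ₂ z) w + ellipsoidForm e κ₁ κ₂ w := by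
  have h1 : rinner (ellipsoidMap e κ₁ κ₂ w) z = rinner (ellipsoidMap e κ₁ κ₂ z) w := by
    rw [rinner_ellipsoidMap, rinner_ellipsoidMap, rinner_comm w z, rinner_inner_smul_comm w z]
  simp only [ellipsoidForm, map_add, rinner_add_left, rinner_add_right, h1]
  ring

lemma continuous_ellipsoidForm : Continuous (ellipsoidForm e κ₁ κ₂) := by
  unfold ellipsoidForm
  fun_prop

lemma norm_inner_sq_le (he : ‖e‖ = 1) (z : E) : ‖inner ℂ e z‖ ^ 2 ≤ ‖z‖ ^ 2 := by
  have := norm_inner_le_norm (𝕜 := ℂ) e z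
  rw [he, one_mul] at this
  gcongr

lemma le_ellipsoidForm (h : κ₂ ≤ κ₁) (z : E) : κ₂ * ‖z‖ ^ 2 ≤ ellipsoidForm e κ₁ κ₂ z := by
  rw [ellipsoidForm_eq]
  nlinarith [mul_nonneg (sub_nonneg.2 h) (sq_nonneg ‖inner ℂ e z‖)]

lemma ellipsoidForm_le (he : ‖e‖ = 1) (h : κ₂ ≤ κ₁) (z : E) :
    ellipsoidForm e κ₁ κ₂ z ≤ κ₁ * ‖z‖ ^ 2 := by
  rw [ellipsoidForm_eq]
  nlinarith [mul_le_mul_of_nonneg_left (norm_inner_sq_le he z) (sub_nonneg.2 h)]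

lemma ellipsoidForm_nonneg (h₂ : 0 ≤ κ₂) (h : κ₂ ≤ κ₁) (z : E) :
    0 ≤ ellipsoidForm e κ₁ κ₂ z :=
  (by positivity : 0 ≤ κ₂ * ‖z‖ ^ 2).trans (le_ellipsoidForm h z)

lemma ellipsoidForm_self (he : ‖e‖ = 1) : ellipsoidForm e κ₁ κ₂ e = κ₁ := by
  rw [ellipsoidForm_eq, inner_self_eq_norm_sq_to_K, he]
  simp

lemma norm_sq_smul_sub_ellipsoidMap (he : ‖e‖ = 1) (a : ℝ) (v : E) :
    ‖(a : ℂ) • v - ellipsoidMap e κ₁ κ₂ v‖ ^ 2 = (a - 2 * κ₂) ^ 2 * (‖v‖ ^ 2 - ‖inner ℂ e v‖ ^ 2)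
      + (a - 2 * κ₁) ^ 2 * ‖inner ℂ e v‖ ^ 2 := by
  have h1 : (a : ℂ) • v - ellipsoidMap e κ₁ κ₂ v = ((a - 2 * κ₂ : ℝ) : ℂ) • v +
      ((2 * (κ₂ - κ₁) : ℝ) : ℂ) • (inner ℂ e v • e) := by
    rw [ellipsoidMap_apply]
    push_cast
    module
  rw [h1, norm_add_sq_rinner, rinner_smul_left, rinner_smul_right, rinner_comm,
    rinner_inner_smul_self, norm_smul, norm_smul, norm_smul, he, mul_pow, mul_pow, mul_pow]
  simp only [Complex.norm_real, Real.norm_eq_abs, sq_abs]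
  ring

lemma exists_le_abs_sub {a : ℝ} (n : ℤ) (h1 : 2 * π * n < a) (h2 : a < 2 * π * (n + 1)) :
    ∃ c : ℝ, 0 < c ∧ ∀ k : ℤ, c ≤ |2 * π * k - a| := by
  refine ⟨min (a - 2 * π * n) (2 * π * (n + 1) - a), lt_min (by linarith) (by linarith),
    fun k => ?_⟩
  rcases le_or_gt k n with h | h
  · refine (min_le_left _ _).trans (le_trans ?_ (neg_le_abs _))
    have : (k : ℝ) ≤ n := by exact_mod_cast h
    nlinarith [pi_pos]
  · refine (min_le_right _ _).trans (le_trans ?_ (le_abs_self _))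
    have : (n : ℝ) + 1 ≤ k := by exact_mod_cast h
    nlinarith [pi_pos]

lemma exists_spectral_gap (he : ‖e‖ = 1) (h1 : π < κ₁) (h1' : κ₁ < 2 * π) (h2 : 0 < κ₂)
    (h2' : κ₂ < π) : ∃ c : ℝ, 0 < c ∧ ∀ (k : ℤ) (v : E),
      c * ‖v‖ ≤ ‖((2 * π * k : ℝ) : ℂ) • v - ellipsoidMap e κ₁ κ₂ v‖ := by
  obtain ⟨c₁, hc₁, H₁⟩ := exists_le_abs_sub (a := 2 * κ₁) 1 (by push_cast; linarith)
    (by push_cast; linarith)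
  obtain ⟨c₂, hc₂, H₂⟩ := exists_le_abs_sub (a := 2 * κ₂) 0 (by push_cast; linarith)
    (by push_cast; linarith)
  refine ⟨min c₁ c₂, lt_min hc₁ hc₂, fun k v => ?_⟩
  have hc : 0 < min c₁ c₂ := lt_min hc₁ hc₂
  refine (sq_le_sq₀ (by positivity) (norm_nonneg _)).1 ?_
  rw [norm_sq_smul_sub_ellipsoidMap he, mul_pow]
  have h3 : (min c₁ c₂) ^ 2 ≤ (2 * π * k - 2 * κ₁) ^ 2 := by
    rw [← sq_abs (2 * π * k - 2 * κ₁)]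
    have := (min_le_left c₁ c₂).trans (H₁ k)
    gcongr
  have h4 : (min c₁ c₂) ^ 2 ≤ (2 * π * k - 2 * κ₂) ^ 2 := by
    rw [← sq_abs (2 * π * k - 2 * κ₂)]
    have := (min_le_right c₁ c₂).trans (H₂ k)
    gcongr
  nlinarith [mul_le_mul_of_nonneg_right h3 (sq_nonneg ‖inner ℂ e v‖),
    mul_le_mul_of_nonneg_right h4 (sub_nonneg.2 (norm_inner_sq_le he v))]

end Ellipsoid

section Capped

variable {E : Type*} [NormedAddCommGroup E] [InnerProductSpace ℂ E]

/-- The Hamiltonian built from a compactly supported `h` with values in `[0, m]`. -/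
def cappedHam (e : E) (κ₁ κ₂ c₀ d m : ℝ) (h : E → ℝ) (z : E) : ℝ :=
  m - h z + huber c₀ d (ellipsoidForm e κ₁ κ₂ z)

/-- The gradient of `cappedHam`. -/
def cappedGrad [FiniteDimensional ℂ E] (e : E) (κ₁ κ₂ c₀ d : ℝ) (h : E → ℝ) (z : E) : E :=
  -rgrad (fderiv ℝ h z) +
    (huberSlope c₀ d (ellipsoidForm e κ₁ κ₂ z) : ℂ) • ellipsoidMap e κ₁ κ₂ z

variable {e : E} {κ₁ κ₂ c₀ d m : ℝ} {h : E → ℝ}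

lemma exists_tameHamiltonian [FiniteDimensional ℂ E] (h1 : ContDiff ℝ ∞ h)
    (h2 : HasCompactSupport h) (hm : ∀ z, h z ≤ m) (hκ₂ : 0 < κ₂) (hκ : κ₂ ≤ κ₁) (hc₀ : 0 ≤ c₀)
    (hd : 0 < d) : ∃ C, TameHamiltonian (cappedHam e κ₁ κ₂ c₀ d m h)
      (cappedGrad e κ₁ κ₂ c₀ d h) (ellipsoidMap e κ₁ κ₂) C := by
  obtain ⟨A, hA0, hA1, hA2⟩ := exists_taylor_bound h1 h2
  set Q := ellipsoidMap e κ₁ κ₂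
  set q := ellipsoidForm e κ₁ κ₂ with hq
  have hqc : Continuous q := continuous_ellipsoidForm
  refine ⟨A + (c₀ + d) + ‖Q‖ * √((c₀ + d) / κ₂), ?_, ?_, fun z => ?_, by positivity,
    fun z w => ?_, fun z => ?_, fun z => ?_⟩
  · exact (continuous_const.sub h1.continuous).add ((continuous_huber c₀ d).comp hqc)
  · have h3 : Continuous (fderiv ℝ h) := h1.continuous_fderiv (by norm_num)
    have h4 : Continuous fun z => huberSlope c₀ d (q z) := (continuous_huberSlope c₀ d).comp hqc
    exact (continuous_rgrad.comp h3).neg.add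
      ((Complex.continuous_ofReal.comp h4).smul Q.continuous)
  · exact add_nonneg (sub_nonneg.2 (hm z)) (huber_nonneg hd _)
  · have h3 := (abs_le.1 (hA2 z w)).2
    have h4 := huber_add_le (c₀ := c₀) hd (q z) (q (z + w))
    have h5 : q (z + w) - q z = rinner (Q z) w + q w := by rw [hq, ellipsoidForm_add]; ring
    have h6 := mul_nonneg (huberSlope_nonneg c₀ d (q z))
      (ellipsoidForm_nonneg (e := e) hκ₂.le hκ w)
    have h7 : rinner (cappedGrad e κ₁ κ₂ c₀ d h z) w =
        -fderiv ℝ h z w + huberSlope c₀ d (q z) * rinner (Q z) w := by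
      rw [cappedGrad, rinner_add_left, rinner_smul_left, rinner_neg_left, rinner_rgrad]
    have h8 : A * ‖w‖ ^ 2 ≤ (A + (c₀ + d) + ‖Q‖ * √((c₀ + d) / κ₂)) * ‖w‖ ^ 2 := by
      gcongr
      have : 0 ≤ ‖Q‖ * √((c₀ + d) / κ₂) := by positivity
      linarith
    rw [h5, mul_add] at h4
    simp only [cappedHam, ← hq]
    rw [h7]
    linarith
  · have h3 : ‖(huberSlope c₀ d (q z) : ℂ) • Q z - Q z‖ ≤ ‖Q‖ * √((c₀ + d) / κ₂) := by
      rcases le_total (c₀ + d) (q z) with h | h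
      · rw [huberSlope_of_ge hd h, Complex.ofReal_one, one_smul, sub_self, norm_zero]
        positivity
      · have h4 : ‖z‖ ≤ √((c₀ + d) / κ₂) := by
          apply Real.le_sqrt_of_sq_le
          rw [le_div_iff₀ hκ₂, mul_comm]
          exact (le_ellipsoidForm hκ z).trans h
        have h5 : (huberSlope c₀ d (q z) : ℂ) • Q z - Q z =
            ((huberSlope c₀ d (q z) - 1 : ℝ) : ℂ) • Q z := by push_cast; module
        rw [h5, norm_smul, Complex.norm_real, Real.norm_eq_abs]
        have h6 : |huberSlope c₀ d (q z) - 1| ≤ 1 := by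
          rw [abs_le]
          constructor <;> linarith [huberSlope_nonneg c₀ d (q z), huberSlope_le_one c₀ d (q z)]
        calc _ ≤ 1 * ‖Q z‖ := by gcongr
          _ ≤ ‖Q‖ * ‖z‖ := by rw [one_mul]; exact Q.le_opNorm z
          _ ≤ _ := by gcongr
    have h4 : cappedGrad e κ₁ κ₂ c₀ d h z - Q z =
        -rgrad (fderiv ℝ h z) + ((huberSlope c₀ d (q z) : ℂ) • Q z - Q z) := by
      rw [cappedGrad, add_sub_assoc]
    rw [h4]
    refine (norm_add_le _ _).trans ?_
    rw [norm_neg, norm_rgrad]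
    linarith [hA1 z]
  · have h3 := sub_le_huber (c₀ := c₀) hd (q z)
    have h4 : 0 ≤ ‖Q‖ * √((c₀ + d) / κ₂) := by positivity
    have h5 : 1 / 2 * rinner (Q z) z = q z := rfl
    simp only [cappedHam, ← hq]
    linarith [hm z]

lemma cappedHam_add_le (he : ‖e‖ = 1) (hκ₂ : 0 < κ₂) (hκ : κ₂ ≤ κ₁) (hc₀ : 0 ≤ c₀) (hd : 0 < d)
    (h0 : ∀ z, 0 ≤ h z) (hm : 0 ≤ m) {p : E} {ε : ℝ} (hε : 0 < ε)
    (hp : ∀ v, ‖v‖ < ε → cappedHam e κ₁ κ₂ c₀ d m h (p + v) = 0) :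
    ∃ C, 0 ≤ C ∧ ∀ v, cappedHam e κ₁ κ₂ c₀ d m h (p + v) ≤ C * ‖v‖ ^ 4 := by
  have hκ₁ : 0 < κ₁ := hκ₂.trans_le hκ
  refine ⟨(m + κ₁ * (2 * ‖p‖ ^ 2)) / ε ^ 4 + 2 * κ₁ / ε ^ 2, by positivity, fun v => ?_⟩
  rcases lt_or_ge ‖v‖ ε with hv | hv
  · rw [hp v hv]
    positivity
  · have h1 : cappedHam e κ₁ κ₂ c₀ d m h (p + v) ≤ m + κ₁ * (2 * ‖p‖ ^ 2 + 2 * ‖v‖ ^ 2) := by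
      have h2 := huber_le_self (c₀ := c₀) hd hc₀ (ellipsoidForm_nonneg (e := e) hκ₂.le hκ (p + v))
      have h3 := ellipsoidForm_le he hκ (p + v)
      have h4 : κ₁ * ‖p + v‖ ^ 2 ≤ κ₁ * (2 * ‖p‖ ^ 2 + 2 * ‖v‖ ^ 2) := by
        have := norm_add_sq_le_two_mul p v
        gcongr
      rw [cappedHam]
      linarith [h0 (p + v)]
    have h2 : 1 ≤ ‖v‖ ^ 4 / ε ^ 4 := by rw [one_le_div (by positivity)]; gcongr
    have h3 : ‖v‖ ^ 2 ≤ ‖v‖ ^ 4 / ε ^ 2 := by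
      rw [le_div_iff₀ (by positivity)]
      calc ‖v‖ ^ 2 * ε ^ 2 ≤ ‖v‖ ^ 2 * ‖v‖ ^ 2 := by gcongr
        _ = _ := by ring
    calc _ ≤ (m + κ₁ * (2 * ‖p‖ ^ 2)) * 1 + 2 * κ₁ * ‖v‖ ^ 2 := by linarith
      _ ≤ (m + κ₁ * (2 * ‖p‖ ^ 2)) * (‖v‖ ^ 4 / ε ^ 4) + 2 * κ₁ * (‖v‖ ^ 4 / ε ^ 2) := by gcongr
      _ = _ := by ring

end Capped

section SymplecticBall

variable {E : Type*} [NormedAddCommGroup E] [InnerProductSpace ℂ E]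

lemma rinner_I_smul_I_smul (x y : E) :
    rinner (Complex.I • x) (Complex.I • y) = rinner x y := by
  rw [rinner, inner_smul_left, inner_smul_right, ← mul_assoc]
  simp [rinner]

lemma ext_rinner_right {x y : E} (h : ∀ v, rinner x v = rinner y v) : x = y := by
  rw [← sub_eq_zero, ← norm_eq_zero, ← sq_eq_zero_iff, ← rinner_self, rinner_sub_left, h, sub_self]

lemma contDiff_norm_sq_real : ContDiff ℝ ∞ fun z : E => ‖z‖ ^ 2 := by
  let _ := InnerProductSpace.rclikeToReal ℂ E
  exact contDiff_norm_sq ℝ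

lemma fderiv_norm_sq_real (z u : E) : fderiv ℝ (fun z : E => ‖z‖ ^ 2) z u = 2 * rinner z u := by
  let _ := InnerProductSpace.rclikeToReal ℂ E
  have h := (hasStrictFDerivAt_norm_sq z).hasFDerivAt
  refine (congrArg (fun L : E →L[ℝ] ℝ => L u) h.fderiv).trans ?_
  change (2 : ℕ) • rinner z u = _
  rw [two_nsmul, two_mul]

/-- A smooth symplectic embedding of the open ball of radius `r` centered at the origin. -/
structure IsSymplecticBall (φ : E → E) (r : ℝ) : Prop where
  contDiffOn : ContDiffOn ℝ ∞ φ (Metric.ball 0 r)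
  injOn : Set.InjOn φ (Metric.ball 0 r)
  rinner_fderiv : ∀ z ∈ Metric.ball (0 : E) r, ∀ u v,
    rinner (fderiv ℝ φ z u) (Complex.I • fderiv ℝ φ z v) = rinner u (Complex.I • v)

namespace IsSymplecticBall

variable {φ : E → E} {r : ℝ}

lemma contDiffAt (hφ : IsSymplecticBall φ r) {w : E} (hw : w ∈ Metric.ball 0 r) :
    ContDiffAt ℝ ∞ φ w :=
  hφ.contDiffOn.contDiffAt (Metric.isOpen_ball.mem_nhds hw)

lemma hasStrictFDerivAt (hφ : IsSymplecticBall φ r) {w : E} (hw : w ∈ Metric.ball 0 r) :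
    HasStrictFDerivAt φ (fderiv ℝ φ w) w :=
  (hφ.contDiffAt hw).hasStrictFDerivAt (by norm_num)

lemma fderiv_injective (hφ : IsSymplecticBall φ r) {w : E} (hw : w ∈ Metric.ball 0 r) :
    Function.Injective (fderiv ℝ φ w) := by
  rw [injective_iff_map_eq_zero]
  intro u hu
  have h := hφ.rinner_fderiv w hw u (-(Complex.I • u))
  rw [hu] at h
  have h2 : Complex.I • -(Complex.I • u) = u := by
    rw [smul_neg, smul_smul, Complex.I_mul_I, neg_one_smul, neg_neg]
  rw [h2, rinner_self] at h
  simpa [rinner] using h.symm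

variable [FiniteDimensional ℂ E]

lemma exists_fderiv_equiv (hφ : IsSymplecticBall φ r) {w : E} (hw : w ∈ Metric.ball 0 r) :
    ∃ A : E ≃L[ℝ] E, (A : E →L[ℝ] E) = fderiv ℝ φ w := by
  have : FiniteDimensional ℝ E := FiniteDimensional.trans ℝ ℂ E
  exact ⟨(LinearEquiv.ofInjectiveEndo (fderiv ℝ φ w : E →ₗ[ℝ] E)
    (hφ.fderiv_injective hw)).toContinuousLinearEquiv, by ext; rfl⟩

lemma exists_openPartialHomeomorph (hφ : IsSymplecticBall φ r) :
    ∃ Θ : OpenPartialHomeomorph E E, Θ.source = Metric.ball 0 r ∧ (∀ z, Θ z = φ z) ∧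
      ∀ z ∈ Θ.target, ContDiffAt ℝ ∞ Θ.symm z := by
  have : CompleteSpace E := FiniteDimensional.complete ℂ E
  let e := hφ.injOn.toPartialEquiv
  have ho : IsOpenMap (e.source.domRestrict e) := by
    rw [isOpenMap_iff_nhds_le]
    rintro ⟨w, hw⟩
    obtain ⟨A, hA⟩ := hφ.exists_fderiv_equiv hw
    have h1 : HasStrictFDerivAt φ (A : E →L[ℝ] E) w := hA ▸ hφ.hasStrictFDerivAt hw
    change nhds (φ w) ≤ Filter.map (φ ∘ Subtype.val) (nhds (⟨w, hw⟩ : Metric.ball (0 : E) r))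
    rw [← Filter.map_map, map_nhds_subtype_val, Metric.isOpen_ball.nhdsWithin_eq hw,
      h1.map_nhds_eq_of_equiv]
  let Θ := OpenPartialHomeomorph.ofContinuousOpenRestrict e hφ.contDiffOn.continuousOn ho
    Metric.isOpen_ball
  refine ⟨Θ, rfl, fun _ => rfl, fun z hz => ?_⟩
  have hw : Θ.symm z ∈ Metric.ball 0 r := Θ.map_target hz
  obtain ⟨A, hA⟩ := hφ.exists_fderiv_equiv hw
  have h1 : HasFDerivAt φ (A : E →L[ℝ] E) (Θ.symm z) := hA ▸ (hφ.hasStrictFDerivAt hw).hasFDerivAt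
  exact Θ.contDiffAt_symm hz h1 (hφ.contDiffAt hw)

end IsSymplecticBall

end SymplecticBall

section BallHamiltonian

variable {E : Type*} [NormedAddCommGroup E]

/-- The function equal to `F (‖w‖ ^ 2)` at the image of `w` and extended by zero. -/
def ballHam (Θ : OpenPartialHomeomorph E E) (F : ℝ → ℝ) : E → ℝ :=
  Θ.target.indicator fun z => F (‖Θ.symm z‖ ^ 2)

variable {Θ : OpenPartialHomeomorph E E} {F F' : ℝ → ℝ} {r ρ : ℝ}

lemma ballHam_apply {w : E} (hw : w ∈ Θ.source) : ballHam Θ F (Θ w) = F (‖w‖ ^ 2) := by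
  rw [ballHam, Set.indicator_of_mem (Θ.map_source hw), Θ.left_inv hw]

lemma ballHam_mem_Icc {m : ℝ} (hF : ∀ s, 0 ≤ F s ∧ F s ≤ m) (z : E) :
    0 ≤ ballHam Θ F z ∧ ballHam Θ F z ≤ m := by
  by_cases hz : z ∈ Θ.target
  · rw [ballHam, Set.indicator_of_mem hz]
    exact hF _
  · rw [ballHam, Set.indicator_of_notMem hz]
    exact ⟨le_rfl, (hF 0).1.trans (hF 0).2⟩

lemma ballHam_of_notMem (hF : ∀ s, ρ ^ 2 ≤ s → F s = 0) (hρ : 0 ≤ ρ) {z : E}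
    (hz : z ∉ Θ '' Metric.closedBall 0 ρ) : ballHam Θ F z = 0 := by
  by_cases hz' : z ∈ Θ.target
  · rw [ballHam, Set.indicator_of_mem hz', hF]
    by_contra! h
    refine hz ⟨Θ.symm z, ?_, Θ.right_inv hz'⟩
    rw [mem_closedBall_zero_iff]
    exact (abs_lt_of_sq_lt_sq h hρ |>.trans_eq' (abs_norm _)).le
  · exact Set.indicator_of_notMem hz' _

lemma isCompact_image_closedBall [ProperSpace E] (hs : Θ.source = Metric.ball 0 r) (hρr : ρ < r) :
    IsCompact (Θ '' Metric.closedBall 0 ρ) :=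
  (isCompact_closedBall 0 ρ).image_of_continuousOn
    (Θ.continuousOn.mono (hs ▸ Metric.closedBall_subset_ball hρr))

lemma ballHam_eventuallyEq_zero [ProperSpace E] (hs : Θ.source = Metric.ball 0 r) (hρr : ρ < r)
    (hF : ∀ s, ρ ^ 2 ≤ s → F s = 0) (hρ : 0 ≤ ρ) {z : E}
    (hz : z ∉ Θ '' Metric.closedBall 0 ρ) : ballHam Θ F =ᶠ[nhds z] fun _ => 0 := by
  filter_upwards [(isCompact_image_closedBall hs hρr).isClosed.isOpen_compl.mem_nhds hz] with y hy
  exact ballHam_of_notMem hF hρ hy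

lemma hasCompactSupport_ballHam [ProperSpace E] (hs : Θ.source = Metric.ball 0 r) (hρr : ρ < r)
    (hF : ∀ s, ρ ^ 2 ≤ s → F s = 0) (hρ : 0 ≤ ρ) : HasCompactSupport (ballHam Θ F) :=
  HasCompactSupport.intro (isCompact_image_closedBall hs hρr) fun _ => ballHam_of_notMem hF hρ

variable [InnerProductSpace ℂ E]

lemma contDiff_ballHam [ProperSpace E] (hs : Θ.source = Metric.ball 0 r) (hρr : ρ < r)
    (hsm : ∀ z ∈ Θ.target, ContDiffAt ℝ ∞ Θ.symm z) (hFs : ContDiff ℝ ∞ F)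
    (hF : ∀ s, ρ ^ 2 ≤ s → F s = 0) (hρ : 0 ≤ ρ) : ContDiff ℝ ∞ (ballHam Θ F) := by
  rw [contDiff_iff_contDiffAt]
  intro z
  by_cases hz : z ∈ Θ '' Metric.closedBall 0 ρ
  · obtain ⟨w, hw, rfl⟩ := hz
    have hw' : Θ w ∈ Θ.target := Θ.map_source (hs ▸ Metric.closedBall_subset_ball hρr hw)
    have h1 : ContDiffAt ℝ ∞ (fun z => F (‖Θ.symm z‖ ^ 2)) (Θ w) :=
      hFs.contDiffAt.comp _ (contDiff_norm_sq_real.contDiffAt.comp _ (hsm _ hw'))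
    refine h1.congr_of_eventuallyEq ?_
    filter_upwards [Θ.open_target.mem_nhds hw'] with y hy
    exact Set.indicator_of_mem hy _
  · exact contDiffAt_const.congr_of_eventuallyEq (ballHam_eventuallyEq_zero hs hρr hF hρ hz)

lemma fderiv_symm_fderiv (hΘ : IsSymplecticBall Θ r) (hs : Θ.source = Metric.ball 0 r)
    (hsm : ∀ z ∈ Θ.target, ContDiffAt ℝ ∞ Θ.symm z) {w : E} (hw : w ∈ Metric.ball 0 r) (v : E) :
    fderiv ℝ Θ.symm (Θ w) (fderiv ℝ Θ w v) = v := by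
  have hw' : w ∈ Θ.source := hs ▸ hw
  have h1 := ((hsm _ (Θ.map_source hw')).differentiableAt (by norm_num)).hasFDerivAt.comp w
    (hΘ.hasStrictFDerivAt hw).hasFDerivAt
  have h2 : HasFDerivAt (Θ.symm ∘ Θ) (ContinuousLinearMap.id ℝ E) w := by
    refine (hasFDerivAt_id w).congr_of_eventuallyEq ?_
    filter_upwards [Θ.open_source.mem_nhds hw'] with y hy
    exact Θ.left_inv hy
  exact congrArg (fun L : E →L[ℝ] E => L v) (h1.unique h2)

lemma fderiv_ballHam [FiniteDimensional ℂ E] (hΘ : IsSymplecticBall Θ r)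
    (hs : Θ.source = Metric.ball 0 r) (hh : ContDiff ℝ ∞ (ballHam Θ F))
    (hF : ∀ s, HasDerivAt F (F' s) s) {w : E} (hw : w ∈ Metric.ball 0 r) (v : E) :
    fderiv ℝ (ballHam Θ F) (Θ w) (fderiv ℝ Θ w v) = F' (‖w‖ ^ 2) * (2 * rinner w v) := by
  have h1 := (hh.differentiable (by norm_num) (Θ w)).hasFDerivAt.comp w
    (hΘ.hasStrictFDerivAt hw).hasFDerivAt
  have h2 := (hF (‖w‖ ^ 2)).comp_hasFDerivAt w
    ((contDiff_norm_sq_real (E := E)).differentiable (by norm_num) w).hasFDerivAt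
  have h3 : ballHam Θ F ∘ Θ =ᶠ[nhds w] F ∘ fun z => ‖z‖ ^ 2 := by
    filter_upwards [Metric.isOpen_ball.mem_nhds hw] with y hy
    exact ballHam_apply (hs ▸ hy)
  have h4 := congrArg (fun L : E →L[ℝ] ℝ => L v) (h1.unique (h2.congr_of_eventuallyEq h3))
  simpa [fderiv_norm_sq_real] using h4

/-- The Hamiltonian vector field of `m - ballHam Θ F` is the image of a multiple of the rotation
field. -/
lemma I_smul_neg_rgrad_ballHam [FiniteDimensional ℂ E] (hΘ : IsSymplecticBall Θ r)
    (hs : Θ.source = Metric.ball 0 r) (hh : ContDiff ℝ ∞ (ballHam Θ F))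
    (hF : ∀ s, HasDerivAt F (F' s) s) {w : E} (hw : w ∈ Metric.ball 0 r) :
    Complex.I • -rgrad (fderiv ℝ (ballHam Θ F) (Θ w)) =
      fderiv ℝ Θ w (((-2 * F' (‖w‖ ^ 2) : ℝ) : ℂ) • (Complex.I • w)) := by
  refine ext_rinner_right fun v => ?_
  have hI : v = Complex.I • (-(Complex.I • v)) := by
    rw [smul_neg, smul_smul, Complex.I_mul_I, neg_one_smul, neg_neg]
  obtain ⟨A, hA⟩ := hΘ.exists_fderiv_equiv hw
  obtain ⟨u, hu⟩ := A.surjective (-(Complex.I • v))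
  have hu' : fderiv ℝ Θ w u = -(Complex.I • v) := by rw [← hA]; exact hu
  rw [hI, ← hu', rinner_I_smul_I_smul, rinner_neg_left, rinner_rgrad,
    fderiv_ballHam hΘ hs hh hF hw, hΘ.rinner_fderiv w hw, rinner_smul_left, rinner_I_smul_I_smul]
  ring

end BallHamiltonian

section Rotation

variable {E : Type*} [NormedAddCommGroup E] [InnerProductSpace ℂ E]

lemma hasDerivAt_norm_sq_of_rotation {y : ℝ → E} {a t : ℝ}
    (h : HasDerivAt y ((a : ℂ) • (Complex.I • y t)) t) : HasDerivAt (fun t => ‖y t‖ ^ 2) 0 t := by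
  have h1 := ((contDiff_norm_sq_real (E := E)).differentiable
    (by norm_num) (y t)).hasFDerivAt.comp_hasDerivAt t h
  rwa [fderiv_norm_sq_real, rinner_smul_right, rinner_I_smul_self, mul_zero, mul_zero] at h1

/-- A `1`-periodic uniform rotation with angular speed in `[0, 2π)` is constant. -/
lemma rotation_eq_zero_of_periodic {y : ℝ → E} {a : ℝ} (h0 : 0 ≤ a) (h1 : a < 2 * π)
    (hy : ∀ t, HasDerivAt y ((a : ℂ) • (Complex.I • y t)) t) (hp : y 1 = y 0) (t : ℝ) :
    (a : ℂ) • (Complex.I • y t) = 0 := by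
  have h2 : ∀ t : ℝ, HasDerivAt (fun t : ℝ => Complex.exp (-(a * Complex.I) * (t : ℂ)) • y t) 0 t := by
    intro t
    have h3 : HasDerivAt (fun t : ℝ => Complex.exp (-(a * Complex.I) * (t : ℂ)))
        (Complex.exp (-(a * Complex.I) * t) * (-(a * Complex.I))) t := by
      have h4 : HasDerivAt (fun t : ℝ => -(a * Complex.I) * (t : ℂ)) (-(a * Complex.I)) t := by
        simpa using (Complex.ofRealCLM.hasDerivAt (x := t)).const_mul (-(a * Complex.I))
      exact h4.cexp
    have h5 := h3.fun_smul (hy t)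
    convert h5 using 1
    module
  have h3 : ∀ t : ℝ, Complex.exp (-(a * Complex.I) * (t : ℂ)) • y t = y 0 := fun t => by
    have := is_const_of_deriv_eq_zero (fun t => (h2 t).differentiableAt) (fun t => (h2 t).deriv) t 0
    simpa using this
  rcases eq_or_lt_of_le h0 with h | h
  · simp [← h]
  have h4 := h3 1
  rw [hp] at h4
  have h5 : Complex.exp (-(a * Complex.I) * ((1 : ℝ) : ℂ)) ≠ 1 := by
    rw [Ne, Complex.exp_eq_one_iff]
    rintro ⟨n, hn⟩
    have h6 : -a = n * (2 * π) := by
      have := congrArg Complex.im hn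
      simpa using this
    have h7 : (-1 : ℝ) < n := by nlinarith [pi_pos]
    have h8 : (n : ℝ) < 0 := by nlinarith [pi_pos]
    have h9 : -1 < n := by exact_mod_cast h7
    have h10 : n < 0 := by exact_mod_cast h8
    omega
  have h6 : y 0 = 0 := by
    have : (Complex.exp (-(a * Complex.I) * ((1 : ℝ) : ℂ)) - 1) • y 0 = 0 := by
      rw [sub_smul, h4, one_smul, sub_self]
    exact (smul_eq_zero.1 this).resolve_left (sub_ne_zero.2 h5)
  have h7 : y t = 0 := by
    have := h3 t
    rw [h6] at this
    exact (smul_eq_zero.1 this).resolve_left (Complex.exp_ne_zero _)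
  simp [h7]

end Rotation

section Orbits

variable {E : Type*} [NormedAddCommGroup E] [InnerProductSpace ℂ E] [FiniteDimensional ℂ E]
  {Θ : OpenPartialHomeomorph E E} {F F' : ℝ → ℝ} {r ρ : ℝ} {g : E → E} {O : Set E} {x : ℝ → E}

lemma hasDerivAt_symm_comp (hΘ : IsSymplecticBall Θ r)
    (hs : Θ.source = Metric.ball 0 r) (hsm : ∀ z ∈ Θ.target, ContDiffAt ℝ ∞ Θ.symm z)
    (hh : ContDiff ℝ ∞ (ballHam Θ F)) (hF : ∀ s, HasDerivAt F (F' s) s)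
    (hg : ∀ z ∈ O, g z = -rgrad (fderiv ℝ (ballHam Θ F) z))
    (hx : ∀ t, HasDerivAt x (Complex.I • g (x t)) t) {t : ℝ} (ht : x t ∈ Θ.target)
    (ht' : x t ∈ O) : HasDerivAt (fun t => Θ.symm (x t))
      (((-2 * F' (‖Θ.symm (x t)‖ ^ 2) : ℝ) : ℂ) • (Complex.I • Θ.symm (x t))) t := by
  have h1 := ((hsm _ ht).differentiableAt (by norm_num)).hasFDerivAt.comp_hasDerivAt t (hx t)
  have hw : Θ.symm (x t) ∈ Metric.ball 0 r := hs ▸ Θ.map_target ht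
  have h2 := I_smul_neg_rgrad_ballHam hΘ hs hh hF hw
  have h3 := fderiv_symm_fderiv hΘ hs hsm hw
    (((-2 * F' (‖Θ.symm (x t)‖ ^ 2) : ℝ) : ℂ) • (Complex.I • Θ.symm (x t)))
  rw [← h2, Θ.right_inv ht] at h3
  rw [hg _ ht', h3] at h1
  exact h1

/-- An orbit meeting the image of a sphere stays in it. -/
lemma orbit_mem_image_sphere (hΘ : IsSymplecticBall Θ r)
    (hs : Θ.source = Metric.ball 0 r) (hsm : ∀ z ∈ Θ.target, ContDiffAt ℝ ∞ Θ.symm z)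
    (hh : ContDiff ℝ ∞ (ballHam Θ F)) (hF : ∀ s, HasDerivAt F (F' s) s) (hO : IsOpen O)
    (hg : ∀ z ∈ O, g z = -rgrad (fderiv ℝ (ballHam Θ F) z))
    (hx : ∀ t, HasDerivAt x (Complex.I • g (x t)) t) (hρr : ρ < r)
    (hρO : Θ '' Metric.sphere 0 ρ ⊆ O) {t₀ : ℝ} (ht₀ : x t₀ ∈ Θ '' Metric.sphere 0 ρ) (t : ℝ) :
    x t ∈ Θ '' Metric.sphere 0 ρ := by
  have hxc : Continuous x := continuous_iff_continuousAt.2 fun t => (hx t).continuousAt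
  have : ProperSpace E := FiniteDimensional.proper ℂ E
  have hsub : Metric.sphere (0 : E) ρ ⊆ Θ.source :=
    hs ▸ Metric.sphere_subset_closedBall.trans (Metric.closedBall_subset_ball hρr)
  have hcl : IsClosed (x ⁻¹' (Θ '' Metric.sphere 0 ρ)) :=
    (((isCompact_sphere 0 ρ).image_of_continuousOn (Θ.continuousOn.mono hsub)).isClosed).preimage hxc
  have hop : IsOpen (x ⁻¹' (Θ '' Metric.sphere 0 ρ)) := by
    rw [Metric.isOpen_iff]
    intro t₁ ht₁
    have h1 : IsOpen (x ⁻¹' (Θ.target ∩ O)) := (Θ.open_target.inter hO).preimage hxc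
    have h2 : t₁ ∈ x ⁻¹' (Θ.target ∩ O) := by
      refine ⟨?_, hρO ht₁⟩
      obtain ⟨w, hw, hw'⟩ := ht₁
      exact hw' ▸ Θ.map_source (hsub hw)
    obtain ⟨ε, hε, h3⟩ := Metric.isOpen_iff.1 h1 t₁ h2
    refine ⟨ε, hε, fun t ht => ?_⟩
    have h4 : ∀ t ∈ Metric.ball t₁ ε, HasDerivAt (fun t => ‖Θ.symm (x t)‖ ^ 2) 0 t := fun t ht =>
      hasDerivAt_norm_sq_of_rotation
        (hasDerivAt_symm_comp hΘ hs hsm hh hF hg hx (h3 ht).1 (h3 ht).2)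
    have h5 : ‖Θ.symm (x t)‖ ^ 2 = ‖Θ.symm (x t₁)‖ ^ 2 :=
      Metric.isOpen_ball.is_const_of_deriv_eq_zero
        (convex_ball t₁ ε).isPreconnected
        (fun s hs => (h4 s hs).differentiableAt.differentiableWithinAt)
        (fun s hs => (h4 s hs).deriv) ht (Metric.mem_ball_self hε)
    have h6 : ‖Θ.symm (x t₁)‖ = ρ := by
      obtain ⟨w, hw, hw'⟩ := ht₁
      rw [← hw', Θ.left_inv (hsub hw)]
      exact mem_sphere_zero_iff_norm.1 hw
    refine ⟨Θ.symm (x t), ?_, Θ.right_inv (h3 ht).1⟩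
    rw [mem_sphere_zero_iff_norm, ← h6]
    exact (sq_eq_sq₀ (norm_nonneg _) (norm_nonneg _)).1 h5
  have := IsClopen.eq_univ ⟨hcl, hop⟩ ⟨t₀, ht₀⟩
  exact Set.eq_univ_iff_forall.1 this t

/-- A periodic orbit through the image of the ball is stationary. -/
lemma grad_eq_zero_of_periodic (hΘ : IsSymplecticBall Θ r)
    (hs : Θ.source = Metric.ball 0 r) (hsm : ∀ z ∈ Θ.target, ContDiffAt ℝ ∞ Θ.symm z)
    (hh : ContDiff ℝ ∞ (ballHam Θ F)) (hF : ∀ s, HasDerivAt F (F' s) s)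
    (hF' : ∀ s, -π < F' s ∧ F' s ≤ 0) (hO : IsOpen O)
    (hg : ∀ z ∈ O, g z = -rgrad (fderiv ℝ (ballHam Θ F) z))
    (hx : ∀ t, HasDerivAt x (Complex.I • g (x t)) t) (hper : ∀ t, x (t + 1) = x t) (hρr : ρ < r)
    (hρO : Θ '' Metric.closedBall 0 ρ ⊆ O) {t₀ : ℝ} (ht₀ : x t₀ ∈ Θ '' Metric.closedBall 0 ρ)
    (t : ℝ) : g (x t) = 0 := by
  obtain ⟨w, hw, hw'⟩ := ht₀
  have hwρ : ‖w‖ ≤ ρ := mem_closedBall_zero_iff.1 hw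
  have hsub : Θ '' Metric.sphere 0 ‖w‖ ⊆ O :=
    (Set.image_mono (Metric.sphere_subset_closedBall.trans
      (Metric.closedBall_subset_closedBall hwρ))).trans hρO
  have hmem := orbit_mem_image_sphere hΘ hs hsm hh hF hO hg hx (hwρ.trans_lt hρr) hsub
    (t₀ := t₀) ⟨w, mem_sphere_zero_iff_norm.2 rfl, hw'⟩
  have hball : ∀ v ∈ Metric.sphere (0 : E) ‖w‖, v ∈ Metric.ball (0 : E) r := fun v hv =>
    mem_ball_zero_iff.2 (by rw [mem_sphere_zero_iff_norm.1 hv]; exact hwρ.trans_lt hρr)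
  have hprop : ∀ t, x t ∈ Θ.target ∧ ‖Θ.symm (x t)‖ = ‖w‖ := fun t => by
    obtain ⟨v, hv, hv'⟩ := hmem t
    have hv2 : v ∈ Θ.source := hs ▸ hball v hv
    rw [← hv', Θ.left_inv hv2]
    exact ⟨Θ.map_source hv2, mem_sphere_zero_iff_norm.1 hv⟩
  have hder : ∀ t, HasDerivAt (fun t => Θ.symm (x t))
      (((-2 * F' (‖w‖ ^ 2) : ℝ) : ℂ) • (Complex.I • Θ.symm (x t))) t := fun t => by
    have := hasDerivAt_symm_comp hΘ hs hsm hh hF hg hx (hprop t).1 (hsub (hmem t))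
    rwa [(hprop t).2] at this
  have hzero := rotation_eq_zero_of_periodic (by linarith [hF' (‖w‖ ^ 2)])
    (by linarith [hF' (‖w‖ ^ 2)]) hder (by simpa using congrArg Θ.symm (hper 0)) t
  have hb : Θ.symm (x t) ∈ Metric.ball 0 r := hs ▸ Θ.map_target (hprop t).1
  have h1 := I_smul_neg_rgrad_ballHam hΘ hs hh hF hb
  rw [(hprop t).2, hzero, map_zero, Θ.right_inv (hprop t).1, ← hg _ (hsub (hmem t))] at h1
  exact (smul_eq_zero.1 h1).resolve_left Complex.I_ne_zero

end Orbits

section Nonsqueezing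

variable {E : Type*} [NormedAddCommGroup E] [InnerProductSpace ℂ E] [FiniteDimensional ℂ E]

/-- Orbits of `cappedHam` avoiding the support of `h`, and stationary ones, have nonpositive
action. -/
lemma action_integrand_nonpos {e z : E} {κ₁ κ₂ c₀ d m : ℝ} {h : E → ℝ} (hd : 0 < d) (hc₀ : 0 ≤ c₀)
    (hm : c₀ + d ≤ m) (hH : 0 ≤ cappedHam e κ₁ κ₂ c₀ d m h z)
    (hz : cappedGrad e κ₁ κ₂ c₀ d h z = 0 ∨ h =ᶠ[nhds z] fun _ => 0) :
    1 / 2 * rinner (cappedGrad e κ₁ κ₂ c₀ d h z) z - cappedHam e κ₁ κ₂ c₀ d m h z ≤ 0 := by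
  rcases hz with hz | hz
  · have : rinner (0 : E) z = 0 := by simp [rinner]
    rw [hz, this]
    linarith
  · have h1 : fderiv ℝ h z = 0 := by rw [hz.fderiv_eq]; simp
    have h2 := huberSlope_mul_sub_huber_le hd hc₀ (ellipsoidForm e κ₁ κ₂ z)
    rw [cappedGrad, cappedHam, h1, rgrad_zero, neg_zero, zero_add, rinner_smul_left,
      mul_left_comm, ← ellipsoidForm, hz.eq_of_nhds]
    linarith

/-- Non-squeezing in a complex inner product space: a ball of radius `r` embedded symplectically in
the cylinder of radius `R` over the complex line spanned by `e` satisfies `r ≤ R`. -/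
theorem IsSymplecticBall.radius_le {φ : E → E} {r R : ℝ} {e : E} (hφ : IsSymplecticBall φ r)
    (he : ‖e‖ = 1) (hR : 0 < R) (hcyl : ∀ z ∈ Metric.ball 0 r, ‖inner ℂ e (φ z)‖ < R) :
    r ≤ R := by
  by_contra! hRr
  have : ProperSpace E := FiniteDimensional.proper ℂ E
  obtain ⟨Θ, hs, hΘφ, hsm⟩ := hφ.exists_openPartialHomeomorph
  obtain rfl : (Θ : E → E) = φ := funext hΘφ
  obtain ⟨F, F', m, s₀, s₁, hFs, hF, hF', hm, hs₀, hFm, hs₁, hs₁r, hF0, hFI⟩ := exists_profile hR hRr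
  have hr : 0 < r := hR.trans hRr
  obtain ⟨ρ, hρ, rfl⟩ : ∃ ρ : ℝ, 0 ≤ ρ ∧ ρ ^ 2 = s₁ := ⟨√s₁, Real.sqrt_nonneg _, Real.sq_sqrt hs₁.le⟩
  have hρr : ρ < r := lt_of_pow_lt_pow_left₀ 2 hr.le hs₁r
  set h := ballHam Θ F with hh_def
  have hh : ContDiff ℝ ∞ h := contDiff_ballHam hs hρr hsm hFs hF0 hρ
  have hhI := ballHam_mem_Icc (Θ := Θ) hFI
  have hR2 : 0 < R ^ 2 := by positivity
  obtain ⟨κ₁, hκ₁, hκ₁'⟩ := exists_between (show π < min (2 * π) (m / R ^ 2) from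
    lt_min (by linarith [pi_pos]) (by rwa [lt_div_iff₀ hR2]))
  have hκ₁π : κ₁ < 2 * π := hκ₁'.trans_le (min_le_left _ _)
  have hκ₁m : κ₁ * R ^ 2 < m := (lt_div_iff₀ hR2).1 (hκ₁'.trans_le (min_le_right _ _))
  obtain ⟨D, hD0, hD⟩ := (isCompact_image_closedBall hs hρr).isBounded.exists_pos_norm_le
  obtain ⟨d, hd⟩ : ∃ d, d = (m - κ₁ * R ^ 2) / 2 := ⟨_, rfl⟩
  have hd0 : 0 < d := by linarith
  obtain ⟨κ₂, hκ₂, hκ₂'⟩ := exists_between (show 0 < min 1 (d / D ^ 2) by positivity)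
  have hκ₂1 : κ₂ < 1 := hκ₂'.trans_le (min_le_left _ _)
  have hκ₂D : κ₂ * D ^ 2 < d :=
    (lt_div_iff₀ (by positivity)).1 (hκ₂'.trans_le (min_le_right _ _))
  have hπ := pi_gt_three
  have hκ : κ₂ ≤ κ₁ := by linarith
  obtain ⟨c₀, hc₀⟩ : ∃ c₀, c₀ = κ₁ * R ^ 2 + d := ⟨_, rfl⟩
  have hc₀0 : 0 ≤ c₀ := by
    have : 0 ≤ κ₁ * R ^ 2 := mul_nonneg (by linarith) hR2.le
    linarith
  set O : Set E := {z | ellipsoidForm e κ₁ κ₂ z < c₀} with hO_def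
  have hO : IsOpen O := isOpen_lt continuous_ellipsoidForm continuous_const
  have hKO : Θ '' Metric.closedBall 0 ρ ⊆ O := by
    intro z hz
    have h1 : ‖z‖ ≤ D := hD z hz
    obtain ⟨w, hw, rfl⟩ := hz
    have h2 := hcyl w (Metric.closedBall_subset_ball hρr hw)
    rw [hO_def, Set.mem_ofPred_eq, ellipsoidForm_eq, hc₀]
    have h3 : κ₂ * ‖Θ w‖ ^ 2 ≤ κ₂ * D ^ 2 := by gcongr
    have h4 : (κ₁ - κ₂) * ‖inner ℂ e (Θ w)‖ ^ 2 ≤ κ₁ * R ^ 2 := by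
      gcongr
      · linarith
      · linarith
    linarith
  have hg : ∀ z ∈ O, cappedGrad e κ₁ κ₂ c₀ d h z = -rgrad (fderiv ℝ h z) := fun z hz => by
    rw [cappedGrad, huberSlope_of_le hd0 (le_of_lt hz)]
    simp
  obtain ⟨C, hC⟩ := exists_tameHamiltonian (e := e) hh (hasCompactSupport_ballHam hs hρr hF0 hρ)
    (fun z => (hhI z).2) hκ₂ hκ hc₀0 hd0
  have h0 : (0 : E) ∈ Θ.source := hs ▸ Metric.mem_ball_self hr
  have hbase : ∀ᶠ z in nhds (Θ 0), cappedHam e κ₁ κ₂ c₀ d m h z = 0 := by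
    have h1 : ContinuousAt (fun z => ‖Θ.symm z‖ ^ 2) (Θ 0) :=
      ((hsm _ (Θ.map_source h0)).continuousAt.norm).pow 2
    have h2 : ∀ᶠ z in nhds (Θ 0), ‖Θ.symm z‖ ^ 2 < s₀ :=
      h1.eventually_lt_const (by simpa [Θ.left_inv h0] using hs₀)
    filter_upwards [h2, Θ.open_target.mem_nhds (Θ.map_source h0),
      hO.mem_nhds (hKO ⟨0, Metric.mem_closedBall_self hρ, rfl⟩)] with z hz1 hz2 hz3
    rw [cappedHam, huber_of_le hd0 (le_of_lt hz3), hh_def, ballHam, Set.indicator_of_mem hz2,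
      hFm _ hz1.le]
    ring
  obtain ⟨ε, hε, hball⟩ := Metric.eventually_nhds_iff.1 hbase
  obtain ⟨C₄, hC₄, hp⟩ := cappedHam_add_le (m := m) he hκ₂ hκ hc₀0 hd0 (fun z => (hhI z).1)
    ((hFI 0).1.trans (hFI 0).2) hε (p := Θ 0) fun v hv => hball (by simpa using hv)
  obtain ⟨c, hc, hgap⟩ := exists_spectral_gap he hκ₁ hκ₁π hκ₂ (by linarith)
  obtain ⟨x, hx, hper, hpos⟩ := hC.exists_periodic_orbit he (ellipsoidForm_self he) hκ₁ hκ₂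
    (fun v => le_ellipsoidForm hκ v) hp hC₄ hc hgap
  refine hpos.not_ge ?_
  rw [← neg_nonneg, ← intervalIntegral.integral_neg]
  refine intervalIntegral.integral_nonneg zero_le_one fun t _ => neg_nonneg.2 ?_
  refine action_integrand_nonpos hd0 hc₀0 (by linarith) (hC.nonneg _) ?_
  by_cases hK : ∃ t₀, x t₀ ∈ Θ '' Metric.closedBall 0 ρ
  · obtain ⟨t₀, ht₀⟩ := hK
    exact Or.inl (grad_eq_zero_of_periodic hφ hs hsm hh hF hF' hO hg hx hper hρr hKO ht₀ t)
  · exact Or.inr (ballHam_eventuallyEq_zero hs hρr hF0 hρ fun ht => hK ⟨t, ht⟩)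

end Nonsqueezing

section Complexification

variable {E : Type*} [NormedAddCommGroup E] [InnerProductSpace ℂ E]

/-- The identification of `ℝ⁴` with a complex inner product space with an orthonormal basis of two
vectors. -/
def complexify (b : OrthonormalBasis (Fin 2) ℂ E) : R4 ≃ₗ[ℝ] E where
  toFun x := (⟨x 0, x 1⟩ : ℂ) • b 0 + (⟨x 2, x 3⟩ : ℂ) • b 1
  invFun z := !₂[(inner ℂ (b 0) z).re, (inner ℂ (b 0) z).im, (inner ℂ (b 1) z).re,
    (inner ℂ (b 1) z).im]
  map_add' x y := by
    rw [add_add_add_comm, ← add_smul, ← add_smul]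
    rfl
  map_smul' a x := by
    rw [RingHom.id_apply, smul_add, ← Complex.coe_smul, ← Complex.coe_smul, smul_smul, smul_smul]
    congr 3 <;> simp
  left_inv x := by
    ext i
    fin_cases i <;> simp [b.inner_eq_ite]
  right_inv z := by
    simpa using b.sum_repr' z

lemma complexify_apply (b : OrthonormalBasis (Fin 2) ℂ E) (x : R4) :
    complexify b x = (⟨x 0, x 1⟩ : ℂ) • b 0 + (⟨x 2, x 3⟩ : ℂ) • b 1 := rfl

lemma inner_complexify (b : OrthonormalBasis (Fin 2) ℂ E) (x y : R4) :
    inner ℂ (complexify b x) (complexify b y) =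
      (starRingEnd ℂ) ⟨x 0, x 1⟩ * ⟨y 0, y 1⟩ + (starRingEnd ℂ) ⟨x 2, x 3⟩ * ⟨y 2, y 3⟩ := by
  simp [complexify_apply, b.inner_eq_ite, mul_comm]

lemma norm_complexify (b : OrthonormalBasis (Fin 2) ℂ E) (x : R4) : ‖complexify b x‖ = ‖x‖ := by
  rw [← sq_eq_sq₀ (norm_nonneg _) (norm_nonneg _), ← rinner_self, rinner, inner_complexify,
    EuclideanSpace.real_norm_sq_eq, Fin.sum_univ_four]
  simp
  ring

lemma rinner_complexify (b : OrthonormalBasis (Fin 2) ℂ E) (x y : R4) :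
    rinner (complexify b x) (Complex.I • complexify b y) = -omegaSt x y := by
  rw [rinner, inner_smul_right, inner_complexify, omegaSt]
  simp
  ring

lemma norm_inner_complexify (b : OrthonormalBasis (Fin 2) ℂ E) (x : R4) :
    ‖inner ℂ (b 0) (complexify b x)‖ ^ 2 = x 0 ^ 2 + x 1 ^ 2 := by
  rw [complexify_apply, inner_add_right, inner_smul_right, inner_smul_right, b.inner_eq_ite,
    b.inner_eq_ite, ← Complex.normSq_eq_norm_sq, Complex.normSq_apply]
  simp
  ring

/-- A symplectic embedding of a ball of `ℝ⁴`, transported to a complex inner product space. -/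
lemma isSymplecticBall_complexify [FiniteDimensional ℂ E] (b : OrthonormalBasis (Fin 2) ℂ E)
    {φ : R4 → R4} {r : ℝ}
    (h1 : ContDiffOn ℝ ∞ φ (Metric.ball 0 r)) (h2 : Set.InjOn φ (Metric.ball 0 r))
    (h3 : ∀ x ∈ Metric.ball (0 : R4) r, ∀ u v : R4,
      omegaSt (fderiv ℝ φ x u) (fderiv ℝ φ x v) = omegaSt u v) :
    IsSymplecticBall (fun z => complexify b (φ ((complexify b).symm z))) r := by
  have hmem : ∀ z ∈ Metric.ball (0 : E) r, (complexify b).symm z ∈ Metric.ball (0 : R4) r := by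
    intro z hz
    rw [mem_ball_zero_iff] at hz ⊢
    rwa [← norm_complexify b, LinearEquiv.apply_symm_apply]
  have : FiniteDimensional ℝ E := FiniteDimensional.trans ℝ ℂ E
  let T : R4 ≃L[ℝ] E := (complexify b).toContinuousLinearEquiv
  refine ⟨?_, ?_, ?_⟩
  · exact T.contDiff.comp_contDiffOn (h1.comp T.symm.contDiff.contDiffOn hmem)
  · intro z hz w hw hzw
    exact (complexify b).symm.injective
      (h2 (hmem z hz) (hmem w hw) ((complexify b).injective hzw))
  · intro z hz u v
    have hd : DifferentiableAt ℝ φ (T.symm z) :=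
      (h1.contDiffAt (Metric.isOpen_ball.mem_nhds (hmem z hz))).differentiableAt (by norm_num)
    have hf : ∀ u, fderiv ℝ (fun z => complexify b (φ ((complexify b).symm z))) z u =
        complexify b (fderiv ℝ φ ((complexify b).symm z) ((complexify b).symm u)) := fun u => by
      have := T.hasFDerivAt.comp z (hd.hasFDerivAt.comp z T.symm.hasFDerivAt)
      exact congrArg (fun L : E →L[ℝ] E => L u) this.fderiv
    rw [hf, hf, rinner_complexify, h3 _ (hmem z hz), ← rinner_complexify b]
    simp

end Complexification

/-- Gromov's non-squeezing theorem in dimension 4: the open ball of radius r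
embeds symplectically into the open cylinder Z_R = B²_R × ℝ² if and only if
r ≤ R. -/
theorem symplectic_nonsqueezing (r R : ℝ) (hr : 0 < r) (hR : 0 < R) :
    (∃ φ : R4 → R4,
      ContDiffOn ℝ ∞ φ (Metric.ball (0 : R4) r) ∧
      Set.InjOn φ (Metric.ball (0 : R4) r) ∧
      φ '' Metric.ball (0 : R4) r ⊆ {x : R4 | x 0 ^ 2 + x 1 ^ 2 < R ^ 2} ∧
      ∀ x ∈ Metric.ball (0 : R4) r, ∀ u v : R4,
        omegaSt (fderiv ℝ φ x u) (fderiv ℝ φ x v) = omegaSt u v) ↔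
    r ≤ R := by
  constructor
  · rintro ⟨φ, h1, h2, h3, h4⟩
    let b := EuclideanSpace.basisFun (Fin 2) ℂ
    refine (isSymplecticBall_complexify b h1 h2 h4).radius_le (b.norm_eq_one 0) hR fun z hz => ?_
    have hz' : (complexify b).symm z ∈ Metric.ball (0 : R4) r := by
      rw [mem_ball_zero_iff] at hz ⊢
      rwa [← norm_complexify b, LinearEquiv.apply_symm_apply]
    refine lt_of_pow_lt_pow_left₀ 2 hR.le ?_
    rw [norm_inner_complexify]
    exact h3 ⟨_, hz', rfl⟩
  · intro hrR
    refine ⟨id, contDiffOn_id, Set.injOn_id _, ?_, fun x _ u v => by simp⟩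
    rintro _ ⟨x, hx, rfl⟩
    rw [mem_ball_zero_iff] at hx
    have h1 : ‖x‖ ^ 2 < R ^ 2 := by
      have := hx.trans_le hrR
      gcongr
    rw [EuclideanSpace.real_norm_sq_eq, Fin.sum_univ_four] at h1
    change x 0 ^ 2 + x 1 ^ 2 < R ^ 2
    nlinarith [sq_nonneg (x 2), sq_nonneg (x 3)]
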